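/- arXiv:2208.01381 — 2 statements merged into one kernel-verified Lean document; each statement's English description precedes it below -/
import Mathlib

section
/- For every n ≥ 2 there exists a constant κ_n > 0, depending only on n, with the following property. Let Φ: [0,∞) → [0,∞) be convex and non-decreasing, let o ∈ ℝ^n, R > 0, α ∈ (1, n/(n−1)), and let b be an ℝ^n-valued C¹ map on an open set containing the closed ball of center o and radius 2R. Then for all distinct points x, y ∈ B(o,R): Φ( |b(x) − b(y)| / |x−y| ) ≤ (1/σ_{n−1}) ( ∫_{B(0,2R)} |z|^{−α(n−1)} dz )^{1/α} · (1/|x−y|) · ( ∫_{B(o,2R)} Φ(κ_n ‖Db(z)‖)^{α/(α−1)} dz )^{(α−1)/α}. -/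
open MeasureTheory Metric
open scoped ENNReal

lemma aux_inner (n : ℕ) (hn : 1 ≤ n) (a : ℝ) (ha : 0 < a) :
    ∫⁻ t in Set.Ioi a, ENNReal.ofReal (t ^ (-((n:ℝ)+1))) = ENNReal.ofReal (a ^ (-(n:ℝ)) / n) := by
  have hn' : (1:ℝ) ≤ n := by exact_mod_cast hn
  rw [← ofReal_integral_eq_lintegral_ofReal]
  · rw [integral_Ioi_rpow_of_lt (by linarith) ha]
    congr 1
    rw [show -((n:ℝ)+1)+1 = -n by ring, neg_div_neg_eq]
  · exact integrableOn_Ioi_rpow_of_lt (by linarith) ha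
  · filter_upwards [ae_restrict_mem measurableSet_Ioi] with t ht
    exact Real.rpow_nonneg (ha.le.trans (le_of_lt ht)) _

lemma aux_scale (n : ℕ) (t : ℝ) (ht : 0 < t) (F : EuclideanSpace ℝ (Fin n) → ℝ≥0∞)
    (hF : Measurable F) :
    ∫⁻ z, F (t • z) = ENNReal.ofReal (t ^ (-(n:ℝ))) * ∫⁻ w, F w := by
  rw [← lintegral_map (f := F) (g := fun z : EuclideanSpace ℝ (Fin n) => t • z) hF (by fun_prop),
    Measure.map_addHaar_smul _ ht.ne', lintegral_smul_measure]
  rw [smul_eq_mul, finrank_euclideanSpace_fin, Real.rpow_neg ht.le, Real.rpow_natCast,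
    abs_of_pos (by positivity)]

lemma aux_kernel0 (n : ℕ) (hn : 1 ≤ n) (d : ℝ) (hd : 0 < d)
    (G : EuclideanSpace ℝ (Fin n) → ℝ≥0∞) (hG : Measurable G) :
    ∫⁻ z in ball (0 : EuclideanSpace ℝ (Fin n)) d, ∫⁻ t in Set.Ioo (0:ℝ) 1, G (t • z) * ‖z‖ₑ ≤
    ENNReal.ofReal (d ^ n / n) * ∫⁻ w, G w * ENNReal.ofReal (‖w‖ ^ (-((n:ℝ)-1))) := by
  have hn' : (1:ℝ) ≤ n := by exact_mod_cast hn
  let H : ℝ → EuclideanSpace ℝ (Fin n) → ℝ≥0∞ := fun t w =>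
    Set.indicator {q : ℝ × EuclideanSpace ℝ (Fin n) | ‖q.2‖ < q.1 * d}
      (fun q => G q.2 * ‖q.2‖ₑ * ENNReal.ofReal q.1⁻¹) (t, w)
  have hset : MeasurableSet {q : ℝ × EuclideanSpace ℝ (Fin n) | ‖q.2‖ < q.1 * d} :=
    measurableSet_lt (by fun_prop) (by fun_prop)
  have hH : Measurable (Function.uncurry H) := by
    apply Measurable.indicator _ hset
    fun_prop
  rw [← lintegral_indicator measurableSet_ball]
  calc _ = ∫⁻ z : EuclideanSpace ℝ (Fin n), ∫⁻ t in Set.Ioo (0:ℝ) 1, H t (t • z) := by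
        apply lintegral_congr
        intro z
        by_cases hz : z ∈ ball (0 : EuclideanSpace ℝ (Fin n)) d
        · rw [Set.indicator_of_mem hz]
          apply setLIntegral_congr_fun measurableSet_Ioo
          intro t ht
          have hz' : ‖z‖ < d := by simpa using hz
          have ht0 := ht.1
          simp only [H]
          rw [Set.indicator_of_mem]
          · simp only [enorm_smul]
            rw [Real.enorm_eq_ofReal ht0.le, ENNReal.ofReal_inv_of_pos ht0]
            have h0 : ENNReal.ofReal t ≠ 0 := by simpa using ht0
            rw [mul_assoc, mul_comm (ENNReal.ofReal t), mul_assoc, 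
              ENNReal.mul_inv_cancel h0 ENNReal.ofReal_ne_top, mul_one]
          · simp only [Set.mem_ofPred_eq, norm_smul, Real.norm_eq_abs, abs_of_pos ht0]
            gcongr
        · rw [Set.indicator_of_notMem hz]
          symm
          rw [setLIntegral_congr_fun (g := fun _ => 0) measurableSet_Ioo, lintegral_zero]
          intro t ht
          have ht0 := ht.1
          simp only [H]
          rw [Set.indicator_of_notMem]
          have hz' : d ≤ ‖z‖ := by simpa using hz
          simp only [Set.mem_ofPred_eq, norm_smul, Real.norm_eq_abs, abs_of_pos ht0, not_lt]
          gcongr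
    _ = ∫⁻ t in Set.Ioo (0:ℝ) 1, ∫⁻ z : EuclideanSpace ℝ (Fin n), H t (t • z) := by
        rw [lintegral_lintegral_swap]
        apply Measurable.aemeasurable
        exact hH.comp (f := fun q : EuclideanSpace ℝ (Fin n) × ℝ => (q.2, q.2 • q.1)) (by fun_prop)
    _ = ∫⁻ t in Set.Ioo (0:ℝ) 1, ∫⁻ w : EuclideanSpace ℝ (Fin n),
          ENNReal.ofReal (t ^ (-(n:ℝ))) * H t w := by
        apply setLIntegral_congr_fun measurableSet_Ioo
        intro t ht
        have hm : Measurable (H t) := hH.comp (f := fun q => (t, q)) (by fun_prop)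
        simp only
        rw [aux_scale n t ht.1 (H t) hm, lintegral_const_mul _ hm]
    _ = ∫⁻ w : EuclideanSpace ℝ (Fin n), ∫⁻ t in Set.Ioo (0:ℝ) 1,
          ENNReal.ofReal (t ^ (-(n:ℝ))) * H t w := by
        rw [lintegral_lintegral_swap]
        apply Measurable.aemeasurable
        apply Measurable.mul _ hH
        fun_prop
    _ ≤ ∫⁻ w : EuclideanSpace ℝ (Fin n), ENNReal.ofReal (d ^ n / n) *
          (G w * ENNReal.ofReal (‖w‖ ^ (-((n:ℝ)-1)))) := by
        apply lintegral_mono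
        intro w
        beta_reduce
        by_cases hw : w = 0
        · subst hw
          simp [H, Set.indicator]
        have hw0 : 0 < ‖w‖ := norm_pos_iff.2 hw
        calc _ ≤ ∫⁻ t in Set.Ioi (‖w‖ / d),
              (G w * ‖w‖ₑ) * ENNReal.ofReal (t ^ (-((n:ℝ)+1))) := by
              rw [← lintegral_indicator measurableSet_Ioo, ← lintegral_indicator measurableSet_Ioi]
              apply lintegral_mono
              intro t
              simp only
              by_cases ht : t ∈ Set.Ioo (0:ℝ) 1
              · rw [Set.indicator_of_mem ht]
                by_cases ht2 : ‖w‖ < t * d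
                · rw [Set.indicator_of_mem]
                  · simp only [H]
                    rw [Set.indicator_of_mem (by exact ht2)]
                    simp only
                    rw [neg_add, Real.rpow_add ht.1, Real.rpow_neg_one,
                      ENNReal.ofReal_mul (Real.rpow_nonneg ht.1.le _)]
                    apply le_of_eq
                    ring
                  · rw [Set.mem_Ioi, div_lt_iff₀ hd]
                    exact ht2
                · simp only [H]
                  rw [Set.indicator_of_notMem (by exact ht2)]
                  simp
              · rw [Set.indicator_of_notMem ht]
                simp
          _ = _ := by
              rw [lintegral_const_mul _ (by fun_prop), aux_inner n hn _ (by positivity),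
                ← ofReal_norm, mul_assoc, ← ENNReal.ofReal_mul hw0.le]
              rw [mul_left_comm, ← ENNReal.ofReal_mul (by positivity)]
              congr 2
              rw [show -((n:ℝ)-1) = -n + 1 by ring, Real.rpow_add hw0, Real.rpow_one,
                Real.div_rpow hw0.le hd.le, Real.rpow_neg hd.le, Real.rpow_natCast]
              field_simp
    _ = _ := by
        rw [lintegral_const_mul _ (by fun_prop)]

lemma aux_kernel (n : ℕ) (hn : 1 ≤ n) (d : ℝ) (hd : 0 < d) (x : EuclideanSpace ℝ (Fin n))
    (G : EuclideanSpace ℝ (Fin n) → ℝ≥0∞) (hG : Measurable G) :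
    ∫⁻ z in ball x d, ∫⁻ t in Set.Ioo (0:ℝ) 1, G (x + t • (z - x)) * ‖z - x‖ₑ ≤
    ENNReal.ofReal (d ^ n / n) * ∫⁻ w, G w * ENNReal.ofReal (‖w - x‖ ^ (-((n:ℝ)-1))) := by
  have h := aux_kernel0 n hn d hd (fun w => G (x + w)) (by fun_prop)
  rw [← lintegral_indicator measurableSet_ball] at h ⊢
  have e1 := lintegral_add_right_eq_self (μ := volume) ((ball x d).indicator
    (fun z => ∫⁻ t in Set.Ioo (0:ℝ) 1, G (x + t • (z - x)) * ‖z - x‖ₑ)) x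
  have e2 := lintegral_add_right_eq_self (μ := volume)
    (fun w => G w * ENNReal.ofReal (‖w - x‖ ^ (-((n:ℝ)-1)))) x
  rw [← e1, ← e2]
  refine (le_of_eq ?_).trans (h.trans (le_of_eq ?_))
  · apply lintegral_congr
    intro z
    by_cases hz : z ∈ ball (0 : EuclideanSpace ℝ (Fin n)) d
    · rw [Set.indicator_of_mem hz, Set.indicator_of_mem (by simpa [dist_eq_norm] using hz)]
      simp
    · rw [Set.indicator_of_notMem hz, Set.indicator_of_notMem (by simpa [dist_eq_norm] using hz)]
  · congr 1
    apply lintegral_congr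
    intro z
    simp [add_comm]

lemma aux_pot (n : ℕ) (hn : 1 ≤ n) (r : ℝ) (hr : 0 < r) (p x : EuclideanSpace ℝ (Fin n))
    (hx : x ∈ ball p r) (b : EuclideanSpace ℝ (Fin n) → EuclideanSpace ℝ (Fin n))
    (hb : ContDiffOn ℝ 1 b (ball p (2 * r))) :
    ∫⁻ z in ball p (2 * r), ‖b z - b x‖ₑ ≤ ENNReal.ofReal ((4 * r) ^ n / n) *
      ∫⁻ w in ball p (2 * r), ‖fderiv ℝ b w‖ₑ * ENNReal.ofReal (‖w - x‖ ^ (-((n:ℝ)-1))) := by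
  have hcont : ContinuousOn (fderiv ℝ b) (ball p (2 * r)) :=
    hb.continuousOn_fderiv_of_isOpen isOpen_ball le_rfl
  have hxE : x ∈ ball p (2 * r) := ball_subset_ball (by linarith) hx
  let G : EuclideanSpace ℝ (Fin n) → ℝ≥0∞ :=
    (ball p (2 * r)).indicator (fun w => ‖fderiv ℝ b w‖ₑ)
  have hG : Measurable G := by
    have h1 : ContinuousOn (fun w => ‖fderiv ℝ b w‖ₑ) (ball p (2 * r)) := hcont.enorm
    classical
    have h2 : G = (ball p (2*r)).piecewise (fun w => ‖fderiv ℝ b w‖ₑ) (fun _ => 0) := by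
      ext w
      simp [G, Set.indicator, Set.piecewise]
    rw [h2]
    exact h1.measurable_piecewise continuousOn_const measurableSet_ball
  have hmain := aux_kernel n hn (4 * r) (by positivity) x G hG
  have hsub : ball p (2 * r) ⊆ ball x (4 * r) := by
    apply ball_subset_ball'
    have := mem_ball'.1 hx
    linarith
  have hconv : Convex ℝ (ball p (2 * r)) := convex_ball _ _
  calc _ ≤ ∫⁻ z in ball p (2 * r), ∫⁻ t in Set.Ioo (0:ℝ) 1, G (x + t • (z - x)) * ‖z - x‖ₑ := by
        apply setLIntegral_mono' measurableSet_ball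
        intro z hz
        have hmem : ∀ t ∈ Set.Icc (0:ℝ) 1, x + t • (z - x) ∈ ball p (2 * r) := by
          intro t ht
          exact hconv.add_smul_sub_mem hxE hz ht
        have hf : ContDiffOn ℝ 1 (fun t : ℝ => b (x + t • (z - x))) (Set.Icc 0 1) := by
          apply hb.comp (f := fun t : ℝ => x + t • (z - x)) (by fun_prop)
          exact hmem
        have h := enorm_sub_le_lintegral_deriv_of_contDiffOn_Icc hf zero_le_one
        simp only [one_smul, add_sub_cancel, zero_smul, add_zero] at h
        refine h.trans ?_
        rw [← restrict_Ioo_eq_restrict_Icc]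
        apply setLIntegral_mono' measurableSet_Ioo
        intro t ht
        have hm := hmem t ⟨ht.1.le, ht.2.le⟩
        have hd : DifferentiableAt ℝ b (x + t • (z - x)) :=
          (hb.contDiffAt (isOpen_ball.mem_nhds hm)).differentiableAt one_ne_zero
        have hl : HasDerivAt (fun t : ℝ => x + t • (z - x)) (z - x) t := by
          simpa using ((hasDerivAt_id t).smul_const (z - x)).const_add x
        have := (hd.hasFDerivAt.comp_hasDerivAt t hl).deriv
        simp only [Function.comp_def] at this
        rw [this]
        simp only [G]
        rw [Set.indicator_of_mem hm]
        exact ContinuousLinearMap.le_opENorm _ _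
    _ ≤ ∫⁻ z in ball x (4 * r), ∫⁻ t in Set.Ioo (0:ℝ) 1, G (x + t • (z - x)) * ‖z - x‖ₑ :=
        lintegral_mono_set hsub
    _ ≤ _ := hmain
    _ = _ := by
        rw [← lintegral_indicator measurableSet_ball (fun w => ‖fderiv ℝ b w‖ₑ * _)]
        congr 2
        ext w
        simp only [G, Set.indicator]
        split_ifs <;> simp

lemma aux_intble (n : ℕ) (hn : 1 ≤ n) (β r : ℝ) (hβ : β < n) :
    IntegrableOn (fun z : EuclideanSpace ℝ (Fin n) => ‖z‖ ^ (-β)) (ball 0 r) := by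
  refine integrableOn_ball_of_norm_le_rpow (C := 1) (α := β) ?_ ?_ ?_ ?_
  · simpa using hn
  · simpa using hβ
  · filter_upwards with x
    rw [one_mul, Real.norm_of_nonneg (by positivity)]
  · exact Measurable.aestronglyMeasurable (by fun_prop)

lemma aux_mass (n : ℕ) (hn : 1 ≤ n) (r : ℝ) (hr : 0 < r) :
    ∫ z in ball (0 : EuclideanSpace ℝ (Fin n)) r, ‖z‖ ^ (-((n:ℝ)-1)) =
      (n * (volume (ball (0 : EuclideanSpace ℝ (Fin n)) 1)).toReal) * r := by
  have : Nontrivial (EuclideanSpace ℝ (Fin n)) := by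
    apply Module.nontrivial_of_finrank_pos (R := ℝ)
    simpa using (by omega : 0 < n)
  have h := integral_fun_norm_addHaar (volume : Measure (EuclideanSpace ℝ (Fin n)))
    ((Set.Iio r).indicator (fun y : ℝ => y ^ (-((n:ℝ)-1))))
  rw [← integral_indicator measurableSet_ball]
  have e : ∀ z : EuclideanSpace ℝ (Fin n), (ball (0 : EuclideanSpace ℝ (Fin n)) r).indicator
      (fun z => ‖z‖ ^ (-((n:ℝ)-1))) z =
      (Set.Iio r).indicator (fun y : ℝ => y ^ (-((n:ℝ)-1))) ‖z‖ := by
    intro z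
    simp [Set.indicator]
  rw [integral_congr_ae (.of_forall e), h, finrank_euclideanSpace_fin]
  have e2 : ∫ y in Set.Ioi (0:ℝ), y ^ (n - 1) • (Set.Iio r).indicator
      (fun y : ℝ => y ^ (-((n:ℝ)-1))) y = ∫ y in Set.Ioi (0:ℝ), (Set.Iio r).indicator 1 y := by
    apply setIntegral_congr_fun measurableSet_Ioi
    intro y hy
    have hy : 0 < y := hy
    by_cases hyr : y < r
    · simp only [Set.indicator, Set.mem_Iio, hyr, if_true, smul_eq_mul, Pi.one_apply]
      rw [← Real.rpow_natCast, ← Real.rpow_add hy, Nat.cast_sub hn]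
      simp
    · simp [Set.indicator, hyr]
  rw [e2, setIntegral_indicator measurableSet_Iio]
  simp [Set.Ioi_inter_Iio, hr.le, Measure.real, mul_assoc]

lemma aux_diff (n : ℕ) (hn : 1 ≤ n) (r : ℝ) (hr : 0 < r) (p x y : EuclideanSpace ℝ (Fin n))
    (hx : x ∈ ball p r) (hy : y ∈ ball p r)
    (b : EuclideanSpace ℝ (Fin n) → EuclideanSpace ℝ (Fin n))
    (hb : ContDiffOn ℝ 1 b (ball p (2 * r)))
    (hix : IntegrableOn (fun w => ‖fderiv ℝ b w‖ * ‖w - x‖ ^ (-((n:ℝ)-1))) (ball p (2 * r)))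
    (hiy : IntegrableOn (fun w => ‖fderiv ℝ b w‖ * ‖w - y‖ ^ (-((n:ℝ)-1))) (ball p (2 * r))) :
    (n * (volume (ball (0 : EuclideanSpace ℝ (Fin n)) 1)).toReal) * ‖b x - b y‖ ≤ 2 ^ n * (
      (∫ w in ball p (2 * r), ‖fderiv ℝ b w‖ * ‖w - x‖ ^ (-((n:ℝ)-1))) +
      (∫ w in ball p (2 * r), ‖fderiv ℝ b w‖ * ‖w - y‖ ^ (-((n:ℝ)-1)))) := by
  have hn' : (1:ℝ) ≤ n := by exact_mod_cast hn
  have : Nontrivial (EuclideanSpace ℝ (Fin n)) := by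
    apply Module.nontrivial_of_finrank_pos (R := ℝ)
    simpa using (by omega : 0 < n)
  have conv : ∀ x, IntegrableOn (fun w => ‖fderiv ℝ b w‖ * ‖w - x‖ ^ (-((n:ℝ)-1)))
      (ball p (2 * r)) → ∫⁻ w in ball p (2 * r), ‖fderiv ℝ b w‖ₑ * 
        ENNReal.ofReal (‖w - x‖ ^ (-((n:ℝ)-1))) =
      ENNReal.ofReal (∫ w in ball p (2 * r), ‖fderiv ℝ b w‖ * ‖w - x‖ ^ (-((n:ℝ)-1))) := by
    intro x hi
    rw [ofReal_integral_eq_lintegral_ofReal hi (.of_forall fun w => by positivity)]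
    apply lintegral_congr
    intro w
    rw [ENNReal.ofReal_mul (norm_nonneg _), ofReal_norm]
  have px := aux_pot n hn r hr p x hx b hb
  have py := aux_pot n hn r hr p y hy b hb
  rw [conv x hix, ← ENNReal.ofReal_mul (by positivity)] at px
  rw [conv y hiy, ← ENNReal.ofReal_mul (by positivity)] at py
  have hbc := hb.continuousOn
  have key : volume (ball p (2 * r)) * ‖b x - b y‖ₑ ≤ 
      ∫⁻ z in ball p (2 * r), ‖b z - b x‖ₑ + ‖b z - b y‖ₑ := by
    rw [mul_comm, ← setLIntegral_const]
    apply lintegral_mono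
    intro z
    beta_reduce
    have : b x - b y = (b z - b y) - (b z - b x) := by abel
    rw [this, add_comm]
    exact enorm_sub_le
  rw [lintegral_add_left'] at key
  swap
  · exact ((hbc.sub continuousOn_const).enorm).aemeasurable measurableSet_ball
  have key2 := key.trans (add_le_add px py)
  rw [← ENNReal.ofReal_add (by positivity) (by positivity), Measure.addHaar_ball _ _ (by positivity),
    ← ofReal_norm, ← ENNReal.ofReal_toReal (measure_ball_lt_top (μ := volume) (x := (0 : EuclideanSpace ℝ (Fin n))) (r := 1)).ne,
    ← ENNReal.ofReal_mul (by positivity), ← ENNReal.ofReal_mul (by positivity),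
    ENNReal.ofReal_le_ofReal_iff (by positivity), finrank_euclideanSpace_fin] at key2
  rw [← mul_add] at key2
  set S := (∫ w in ball p (2 * r), ‖fderiv ℝ b w‖ * ‖w - x‖ ^ (-((n:ℝ)-1))) +
      (∫ w in ball p (2 * r), ‖fderiv ℝ b w‖ * ‖w - y‖ ^ (-((n:ℝ)-1)))
  set ω := (volume (ball (0 : EuclideanSpace ℝ (Fin n)) 1)).toReal
  have h4 : (4 * r) ^ n = 2 ^ n * (2 * r) ^ n := by rw [← mul_pow]; ring
  rw [h4] at key2
  have hp : 0 < (2 * r) ^ n := by positivity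
  have : (2 * r) ^ n * (n * ω * ‖b x - b y‖) ≤ (2 * r) ^ n * (2 ^ n * S) := by
    calc _ = n * ((2 * r) ^ n * ω * ‖b x - b y‖) := by ring
      _ ≤ n * (2 ^ n * (2 * r) ^ n / n * S) := by gcongr
      _ = _ := by field_simp
  exact le_of_mul_le_mul_left this hp

lemma aux_k (n : ℕ) (hn : 1 ≤ n) (r : ℝ) (hr : 0 < r) (p x : EuclideanSpace ℝ (Fin n))
    (hx : x ∈ ball p r) :
    ∃ k : EuclideanSpace ℝ (Fin n) → ℝ, Measurable k ∧ (∀ w, 0 ≤ k w) ∧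
      IntegrableOn k (ball p (2 * r)) ∧
      (∫ w in ball p (2 * r), k w =
        (n * (volume (ball (0 : EuclideanSpace ℝ (Fin n)) 1)).toReal) * (2 * r)) ∧
      (∀ w, (2:ℝ) ^ (-((n:ℝ)-1)) * ‖w - x‖ ^ (-((n:ℝ)-1)) ≤ k w) ∧
      ∀ α : ℝ, 1 < α → α * ((n:ℝ)-1) < n →
        IntegrableOn (fun w => k w ^ α) (ball p (2 * r)) ∧
        ∫ w in ball p (2 * r), k w ^ α ≤
          ∫ z in ball (0 : EuclideanSpace ℝ (Fin n)) (2 * r), ‖z‖ ^ (-(α * ((n : ℝ) - 1))) := by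
  have hn' : (1:ℝ) ≤ n := by exact_mod_cast hn
  have : Nontrivial (EuclideanSpace ℝ (Fin n)) := by
    apply Module.nontrivial_of_finrank_pos (R := ℝ)
    simpa using (by omega : 0 < n)
  set s : ℝ := (n:ℝ) - 1 with hs
  have hs0 : 0 ≤ s := by linarith
  set S : Set (EuclideanSpace ℝ (Fin n)) := ball 0 (2 * r) \ ball 0 r with hS
  set D : Set (EuclideanSpace ℝ (Fin n)) := ball p (2 * r) \ ball x r with hD
  have hSm : MeasurableSet S := measurableSet_ball.diff measurableSet_ball
  have hDm : MeasurableSet D := measurableSet_ball.diff measurableSet_ball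
  have hsub0 : ball (0 : EuclideanSpace ℝ (Fin n)) r ⊆ ball 0 (2 * r) :=
    ball_subset_ball (by linarith)
  have hsub : ball x r ⊆ ball p (2 * r) := by
    apply ball_subset_ball'
    have := mem_ball.1 hx
    linarith
  have hvol : volume D = volume S := by
    rw [hD, hS, measure_sdiff hsub measurableSet_ball.nullMeasurableSet measure_ball_lt_top.ne,
      measure_sdiff hsub0 measurableSet_ball.nullMeasurableSet measure_ball_lt_top.ne,
      Measure.addHaar_ball_center, Measure.addHaar_ball_center _ x]
  have hSfin : volume S ≠ ⊤ :=
    ((measure_mono Set.sdiff_subset).trans_lt measure_ball_lt_top).ne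
  have hSpos : volume S ≠ 0 := by
    rw [hS, measure_sdiff hsub0 measurableSet_ball.nullMeasurableSet measure_ball_lt_top.ne,
      Measure.addHaar_ball _ _ (by positivity), Measure.addHaar_ball _ _ hr.le, Ne,
      tsub_eq_zero_iff_le, not_le]
    apply ENNReal.mul_lt_mul_left
    · exact (measure_ball_pos _ _ one_pos).ne'
    · exact measure_ball_lt_top.ne
    · rw [ENNReal.ofReal_lt_ofReal_iff (by positivity), finrank_euclideanSpace_fin]
      exact pow_lt_pow_left₀ (by linarith) hr.le (by omega)
  have hSr : 0 < volume.real S := ENNReal.toReal_pos hSpos hSfin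
  have hI1 := aux_intble n hn s (2 * r) (by linarith)
  set c : ℝ := ⨍ z in S, ‖z‖ ^ (-s) with hc
  have hcS : volume.real S * c = ∫ z in S, ‖z‖ ^ (-s) := by
    rw [hc, setAverage_eq, smul_eq_mul, mul_inv_cancel_left₀ hSr.ne']
  have hclow : (2 * r) ^ (-s) ≤ c := by
    have h1 : volume.real S * (2 * r) ^ (-s) ≤ ∫ z in S, ‖z‖ ^ (-s) := by
      have : ∫ z in S, (2 * r) ^ (-s) = volume.real S * (2 * r) ^ (-s) := by
        rw [setIntegral_const, smul_eq_mul]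
      rw [← this]
      apply setIntegral_mono_on _ (hI1.mono_set Set.sdiff_subset) hSm
      · intro z hz
        have h1 : ‖z‖ < 2 * r := by simpa using hz.1
        have h2 : r ≤ ‖z‖ := by simpa using hz.2
        exact Real.rpow_le_rpow_of_nonpos (by linarith) h1.le (by linarith)
      · exact integrableOn_const hSfin
    rw [← hcS] at h1
    exact le_of_mul_le_mul_left h1 hSr
  have hc0 : 0 ≤ c := le_trans (by positivity) hclow
  classical
  let k : EuclideanSpace ℝ (Fin n) → ℝ := fun w => if w ∈ ball x r then ‖w - x‖ ^ (-s) else c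
  have hk : Measurable k := Measurable.ite measurableSet_ball (by fun_prop) (by fun_prop)
  have hk1 : ∀ w ∈ ball x r, k w = ‖w - x‖ ^ (-s) := fun w hw => if_pos hw
  have hk2 : ∀ w ∈ D, k w = c := fun w hw => if_neg hw.2
  have hunion : ball p (2 * r) = ball x r ∪ D := (Set.union_sdiff_cancel hsub).symm
  have gen : ∀ φ : ℝ → ℝ, IntegrableOn (fun z : EuclideanSpace ℝ (Fin n) => φ (‖z‖ ^ (-s)))
      (ball 0 r) → IntegrableOn (fun w => φ (k w)) (ball p (2 * r)) ∧
      ∫ w in ball p (2 * r), φ (k w) = (∫ z in ball (0 : EuclideanSpace ℝ (Fin n)) r,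
        φ (‖z‖ ^ (-s))) + volume.real S * φ c := by
    intro φ hφ
    have hmp : MeasurePreserving (fun w : EuclideanSpace ℝ (Fin n) => w - x) volume volume :=
      measurePreserving_sub_right volume x
    have hemb : MeasurableEmbedding (fun w : EuclideanSpace ℝ (Fin n) => w - x) :=
      (MeasurableEquiv.subRight x).measurableEmbedding
    have hpre : (fun w : EuclideanSpace ℝ (Fin n) => w - x) ⁻¹' (ball 0 r) = ball x r := by
      ext w
      simp [dist_eq_norm]
    have hi1 : IntegrableOn (fun w => φ (k w)) (ball x r) := by
      have := (hmp.integrableOn_comp_preimage hemb).2 hφ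
      rw [hpre] at this
      refine this.congr_fun ?_ measurableSet_ball
      intro w hw
      simp [hk1 w hw]
    have hi2 : IntegrableOn (fun w => φ (k w)) D := by
      refine (integrableOn_const (C := φ c) (hvol ▸ hSfin)).congr_fun ?_ hDm
      intro w hw
      simp [hk2 w hw]
    refine ⟨hunion ▸ hi1.union hi2, ?_⟩
    rw [hunion, setIntegral_union Set.disjoint_sdiff_right hDm hi1 hi2]
    congr 1
    · have := hmp.setIntegral_preimage_emb hemb (fun z => φ (‖z‖ ^ (-s))) (ball 0 r)
      rw [hpre] at this
      rw [← this]
      apply setIntegral_congr_fun measurableSet_ball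
      intro w hw
      simp [hk1 w hw]
    · rw [setIntegral_congr_fun (g := fun _ => φ c) hDm (fun w hw => by simp [hk2 w hw]),
        setIntegral_const, smul_eq_mul, Measure.real, Measure.real, hvol]
  have split : ∀ f : EuclideanSpace ℝ (Fin n) → ℝ, IntegrableOn f (ball 0 (2 * r)) →
      ∫ z in ball 0 (2 * r), f z = (∫ z in ball 0 r, f z) + ∫ z in S, f z := by
    intro f hf
    rw [← setIntegral_union Set.disjoint_sdiff_right hSm (hf.mono_set hsub0)
      (hf.mono_set Set.sdiff_subset), Set.union_sdiff_cancel hsub0]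
  refine ⟨k, hk, ?_, ?_, ?_, ?_, ?_⟩
  · intro w
    simp only [k]
    split_ifs
    · positivity
    · exact hc0
  · exact (gen id (hI1.mono_set hsub0)).1
  · have := (gen id (hI1.mono_set hsub0)).2
    simp only [id] at this
    rw [this, hcS, ← split _ hI1, hs, aux_mass n hn (2 * r) (by positivity)]
  · intro w
    have h2 : (2:ℝ) ^ (-s) ≤ 1 := Real.rpow_le_one_of_one_le_of_nonpos (by norm_num) (by linarith)
    by_cases hw : w ∈ ball x r
    · rw [hk1 w hw]
      exact mul_le_of_le_one_left (by positivity) h2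
    · have : k w = c := if_neg hw
      rw [this]
      refine le_trans ?_ hclow
      rw [Real.mul_rpow (by norm_num) hr.le]
      have hw' : r ≤ ‖w - x‖ := by simpa [dist_eq_norm] using hw
      gcongr ?_ * ?_
      exact Real.rpow_le_rpow_of_nonpos hr hw' (by linarith)
  · intro α hα hαn
    have hI2 := aux_intble n hn (α * s) (2 * r) hαn
    have hpow : ∀ z : EuclideanSpace ℝ (Fin n), ‖z‖ ^ (-(α * s)) = (‖z‖ ^ (-s)) ^ α := by
      intro z
      rw [← Real.rpow_mul (norm_nonneg _)]
      congr 1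
      ring
    simp only [hpow] at hI2 ⊢
    obtain ⟨g1, g2⟩ := gen (fun t => t ^ α) (hI2.mono_set hsub0)
    refine ⟨g1, ?_⟩
    rw [g2, split _ hI2]
    gcongr
    have := (convexOn_rpow hα.le).map_set_average_le (μ := volume) (t := S)
      (f := fun z : EuclideanSpace ℝ (Fin n) => ‖z‖ ^ (-s))
      (Real.continuous_rpow_const (by linarith)).continuousOn isClosed_Ici hSpos hSfin
      (.of_forall fun z => by simp; positivity) (hI1.mono_set Set.sdiff_subset)
      (hI2.mono_set Set.sdiff_subset)
    rw [← hc, setAverage_eq, smul_eq_mul, inv_mul_eq_div, le_div_iff₀ hSr, mul_comm] at this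
    exact this

lemma aux_JH {X : Type*} [MeasurableSpace X] (μ : Measure X) [IsFiniteMeasure μ] (Φ : ℝ → ℝ)
    (hΦ : ConvexOn ℝ (Set.Ici 0) Φ) (hmon : MonotoneOn Φ (Set.Ici 0))
    (hpos : ∀ t : ℝ, 0 ≤ t → 0 ≤ Φ t) (α : ℝ) (hα : 1 < α) (k f : X → ℝ)
    (hk : Measurable k) (hk0 : ∀ w, 0 ≤ k w) (hki : Integrable k μ) (hM : 0 < ∫ w, k w ∂μ)
    (hkα : Integrable (fun w => k w ^ α) μ) (hf : AEStronglyMeasurable f μ) (hf0 : ∀ w, 0 ≤ f w)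
    (B : ℝ) (hB : ∀ᵐ w ∂μ, f w ≤ B) :
    Φ ((∫ w, k w * f w ∂μ) / ∫ w, k w ∂μ) ≤ (1 / ∫ w, k w ∂μ) * (∫ w, k w ^ α ∂μ) ^ (1 / α) *
      (∫ w, (Φ (f w)) ^ (α / (α - 1)) ∂μ) ^ ((α - 1) / α) ∧
    Integrable (fun w => (Φ (f w)) ^ (α / (α - 1))) μ := by
  let Ψ : ℝ → ℝ := fun t => Φ (max t 0)
  have hΨeq : ∀ t, 0 ≤ t → Ψ t = Φ t := fun t ht => by simp [Ψ, ht]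
  have hΨmono : Monotone Ψ := fun a b hab =>
    hmon (by simp) (by simp) (max_le_max hab le_rfl)
  have hΨ0 : ∀ t, 0 ≤ Ψ t := fun t => hpos _ (le_max_right _ _)
  have hΨconv : ConvexOn ℝ Set.univ Ψ := by
    refine ⟨convex_univ, ?_⟩
    intro a _ b _ u v hu hv huv
    have h1 : max (u • a + v • b) 0 ≤ u • max a 0 + v • max b 0 := by
      apply max_le
      · simp only [smul_eq_mul]
        gcongr <;> exact le_max_left _ _
      · simp only [smul_eq_mul]
        positivity
    exact (hmon (by simp) (by simp only [smul_eq_mul, Set.mem_Ici]; positivity) h1).trans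
      (hΦ.2 (by simp) (by simp) hu hv huv)
  have hΨcont : Continuous Ψ := by
    rw [← continuousOn_univ]
    exact hΨconv.continuousOn isOpen_univ
  have hΨf : ∀ w, Φ (f w) = Ψ (f w) := by
    intro w
    rw [hΨeq _ (hf0 w)]
  have hfb : ∀ᵐ w ∂μ, ‖f w‖ ≤ B := by
    filter_upwards [hB] with w hw
    rwa [Real.norm_of_nonneg (hf0 w)]
  have hΨb : ∀ᵐ w ∂μ, ‖Ψ (f w)‖ ≤ Ψ B := by
    filter_upwards [hB] with w hw
    rw [Real.norm_of_nonneg (hΨ0 _)]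
    exact hΨmono hw
  have hΨm : AEStronglyMeasurable (fun w => Ψ (f w)) μ := hΨcont.comp_aestronglyMeasurable hf
  have hconj : α.HolderConjugate (α / (α - 1)) := Real.HolderConjugate.conjExponent hα
  have hLq : MemLp (fun w => Ψ (f w)) (ENNReal.ofReal (α / (α - 1))) μ :=
    MemLp.of_bound hΨm _ hΨb
  have hLp : MemLp k (ENNReal.ofReal α) μ := by
    have := (integrable_norm_rpow_iff (f := k) (μ := μ) (p := ENNReal.ofReal α)
      hk.aestronglyMeasurable (by simpa using by linarith) ENNReal.ofReal_ne_top).1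
    apply this
    rw [ENNReal.toReal_ofReal (by linarith)]
    refine hkα.congr (.of_forall fun w => ?_)
    simp [abs_of_nonneg (hk0 w)]
  have holder := integral_mul_le_Lp_mul_Lq_of_nonneg hconj (.of_forall hk0)
    (.of_forall fun w => hΨ0 (f w)) hLp hLq
  rw [one_div_div] at holder
  refine ⟨?_, ?_⟩
  · let ν := μ.withDensity (fun w => ((k w).toNNReal : ℝ≥0∞))
    have hfin : IsFiniteMeasure ν := isFiniteMeasure_withDensity_ofReal hki.2
    have hint : ∀ g : X → ℝ, ∫ w, g w ∂ν = ∫ w, k w * g w ∂μ := by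
      intro g
      rw [integral_withDensity_eq_integral_smul hk.real_toNNReal]
      apply integral_congr_ae
      refine .of_forall fun w => ?_
      simp [NNReal.smul_def, hk0 w]
    have hac : ν ≪ μ := withDensity_absolutelyContinuous _ _
    have hmass : ν.real Set.univ = ∫ w, k w ∂μ := by
      have := hint (fun _ => 1)
      simpa using this
    have hne : NeZero ν := ⟨by
      intro h
      rw [h] at hmass
      simp at hmass
      linarith⟩
    have hJ := hΨconv.map_average_le (μ := ν) (f := f) hΨcont.continuousOn isClosed_univ
      (by simp) (.of_bound (hf.mono_ac hac) B (hac.ae_le hfb))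
      (.of_bound (hΨm.mono_ac hac) (Ψ B) (hac.ae_le hΨb))
    rw [average_eq, average_eq, hint, hint, hmass, smul_eq_mul, smul_eq_mul, inv_mul_eq_div] at hJ
    simp only [hΨf]
    rw [← hΨeq _ (div_nonneg (integral_nonneg fun w => mul_nonneg (hk0 w) (hf0 w)) hM.le)]
    refine hJ.trans ?_
    rw [one_div, mul_assoc]
    gcongr
  · simp only [hΨf]
    have := hLq.integrable_norm_rpow' 
    rw [ENNReal.toReal_ofReal (hconj.symm.nonneg)] at this
    refine this.congr (.of_forall fun w => ?_)
    simp [abs_of_nonneg (hΨ0 (f w))]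

lemma aux_core (n : ℕ) (hn : 1 ≤ n) (Φ : ℝ → ℝ)
    (hΦ : ConvexOn ℝ (Set.Ici 0) Φ) (hmon : MonotoneOn Φ (Set.Ici 0))
    (hpos : ∀ t : ℝ, 0 ≤ t → 0 ≤ Φ t) (α : ℝ) (hα : 1 < α) (hαn : α * ((n:ℝ)-1) < n)
    (r : ℝ) (hr : 0 < r) (p : EuclideanSpace ℝ (Fin n))
    (b : EuclideanSpace ℝ (Fin n) → EuclideanSpace ℝ (Fin n))
    (hb : ContDiffOn ℝ 1 b (ball p (2 * r)))
    (B : ℝ) (hB : ∀ w ∈ ball p (2 * r), ‖fderiv ℝ b w‖ ≤ B)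
    (x y : EuclideanSpace ℝ (Fin n)) (hx : x ∈ ball p r) (hy : y ∈ ball p r)
    (hxy : r / 2 ≤ ‖x - y‖) :
    Φ (‖b x - b y‖ / ‖x - y‖) ≤
        (1 / ((n : ℝ) * (volume (ball (0 : EuclideanSpace ℝ (Fin n)) 1)).toReal)) *
        (∫ z in ball (0 : EuclideanSpace ℝ (Fin n)) (2 * r),
            ‖z‖ ^ (-(α * ((n : ℝ) - 1)))) ^ (1 / α) *
        (1 / ‖x - y‖) *
        (∫ z in ball p (2 * r), (Φ (8 * 4 ^ n * ‖fderiv ℝ b z‖)) ^ (α / (α - 1)))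
          ^ ((α - 1) / α) := by
  have hn' : (1:ℝ) ≤ n := by exact_mod_cast hn
  have : Nontrivial (EuclideanSpace ℝ (Fin n)) := by
    apply Module.nontrivial_of_finrank_pos (R := ℝ)
    simpa using (by omega : 0 < n)
  have hcont : ContinuousOn (fderiv ℝ b) (ball p (2 * r)) :=
    hb.continuousOn_fderiv_of_isOpen isOpen_ball le_rfl
  set σ : ℝ := (n : ℝ) * (volume (ball (0 : EuclideanSpace ℝ (Fin n)) 1)).toReal with hσ
  have hσ0 : 0 < σ := by
    have : 0 < (volume (ball (0 : EuclideanSpace ℝ (Fin n)) 1)).toReal :=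
      ENNReal.toReal_pos (measure_ball_pos _ _ one_pos).ne' measure_ball_lt_top.ne
    positivity
  have hd0 : 0 < ‖x - y‖ := by linarith
  have hd2 : ‖x - y‖ ≤ 2 * r := by
    have h1 := mem_ball.1 hx
    have h2 := mem_ball.1 hy
    have := dist_triangle_right x y p
    rw [← dist_eq_norm]
    linarith
  set g : EuclideanSpace ℝ (Fin n) → ℝ := fun w => ‖fderiv ℝ b w‖ with hg
  have hgm : AEStronglyMeasurable g (volume.restrict (ball p (2 * r))) :=
    hcont.norm.aestronglyMeasurable measurableSet_ball
  have hgB : ∀ᵐ w ∂(volume.restrict (ball p (2 * r))), ‖g w‖ ≤ B := by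
    filter_upwards [ae_restrict_mem measurableSet_ball] with w hw
    rw [Real.norm_of_nonneg (norm_nonneg _)]
    exact hB w hw
  have hfin : IsFiniteMeasure (volume.restrict (ball p (2 * r))) :=
    ⟨by simpa using measure_ball_lt_top⟩
  obtain ⟨kx, hkx, hkx0, hkxi, hkxM, hkxl, hkxα⟩ := aux_k n hn r hr p x hx
  obtain ⟨ky, hky, hky0, hkyi, hkyM, hkyl, hkyα⟩ := aux_k n hn r hr p y hy
  have half : ∀ k : EuclideanSpace ℝ (Fin n) → ℝ, Measurable k → (∀ w, 0 ≤ k w) →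
      IntegrableOn k (ball p (2 * r)) → (∫ w in ball p (2 * r), k w = σ * (2 * r)) →
      (IntegrableOn (fun w => k w ^ α) (ball p (2 * r)) ∧
        ∫ w in ball p (2 * r), k w ^ α ≤
          ∫ z in ball (0 : EuclideanSpace ℝ (Fin n)) (2 * r), ‖z‖ ^ (-(α * ((n : ℝ) - 1)))) →
      σ * ‖b x - b y‖ ≤ 2 * 4 ^ n * (∫ w in ball p (2 * r), g w * k w) →
      Φ (‖b x - b y‖ / ‖x - y‖) ≤ (1 / σ) *
        (∫ z in ball (0 : EuclideanSpace ℝ (Fin n)) (2 * r),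
            ‖z‖ ^ (-(α * ((n : ℝ) - 1)))) ^ (1 / α) *
        (1 / ‖x - y‖) *
        (∫ z in ball p (2 * r), (Φ (8 * 4 ^ n * g z)) ^ (α / (α - 1))) ^ ((α - 1) / α) := by
    intro k hk hk0 hki hkM hkα hle
    have hJ := (aux_JH (volume.restrict (ball p (2 * r))) Φ hΦ hmon hpos α hα k
      (fun w => 8 * 4 ^ n * g w) hk hk0 hki (by rw [hkM]; positivity) hkα.1
      (hgm.const_mul _) (fun w => by positivity) (8 * 4 ^ n * B) (by
        filter_upwards [hgB] with w hw
        rw [Real.norm_of_nonneg (norm_nonneg _)] at hw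
        gcongr)).1
    have e : ∫ w in ball p (2 * r), k w * (8 * 4 ^ n * g w) =
        8 * 4 ^ n * ∫ w in ball p (2 * r), g w * k w := by
      rw [← integral_const_mul]
      congr 1
      ext w
      ring
    rw [e, hkM] at hJ
    set J := ∫ w in ball p (2 * r), g w * k w
    have hJ0 : 0 ≤ J := integral_nonneg fun w => mul_nonneg (norm_nonneg _) (hk0 w)
    set N := (∫ z in ball p (2 * r), (Φ (8 * 4 ^ n * g z)) ^ (α / (α - 1))) ^ ((α - 1) / α)
    have hN : 0 ≤ N := Real.rpow_nonneg (integral_nonneg fun w =>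
      Real.rpow_nonneg (hpos _ (by positivity)) _) _
    have hle2 : ‖b x - b y‖ / ‖x - y‖ ≤ 8 * 4 ^ n * J / (σ * (2 * r)) := by
      rw [div_le_div_iff₀ hd0 (by positivity)]
      calc ‖b x - b y‖ * (σ * (2 * r)) = (σ * ‖b x - b y‖) * (2 * r) := by ring
        _ ≤ (2 * 4 ^ n * J) * (4 * ‖x - y‖) := by
            exact mul_le_mul hle (by linarith) (by positivity) (by positivity)
        _ = _ := by ring
    refine (hmon (by simp only [Set.mem_Ici]; positivity)
      (by simp only [Set.mem_Ici]; positivity) hle2).trans (hJ.trans ?_)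
    have hA0 : 0 ≤ ∫ w in ball p (2 * r), k w ^ α :=
      integral_nonneg fun w => Real.rpow_nonneg (hk0 w) _
    calc 1 / (σ * (2 * r)) * (∫ w in ball p (2 * r), k w ^ α) ^ (1 / α) * N
        ≤ 1 / (σ * ‖x - y‖) * (∫ z in ball (0 : EuclideanSpace ℝ (Fin n)) (2 * r),
            ‖z‖ ^ (-(α * ((n : ℝ) - 1)))) ^ (1 / α) * N := by
          gcongr
          exact hkα.2
      _ = _ := by
          rw [one_div_mul_eq_div]
          field_simp
  have gk : ∀ k : EuclideanSpace ℝ (Fin n) → ℝ, IntegrableOn k (ball p (2 * r)) →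
      IntegrableOn (fun w => g w * k w) (ball p (2 * r)) := fun k hk => hk.bdd_mul hgm hgB
  have cmp : ∀ (k : EuclideanSpace ℝ (Fin n) → ℝ) (v : EuclideanSpace ℝ (Fin n)),
      IntegrableOn k (ball p (2 * r)) →
      (∀ w, (2:ℝ) ^ (-((n:ℝ)-1)) * ‖w - v‖ ^ (-((n:ℝ)-1)) ≤ k w) →
      IntegrableOn (fun w => g w * ‖w - v‖ ^ (-((n:ℝ)-1))) (ball p (2 * r)) ∧
      ∫ w in ball p (2 * r), g w * ‖w - v‖ ^ (-((n:ℝ)-1)) ≤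
        2 ^ n * ∫ w in ball p (2 * r), g w * k w := by
    intro k v hk hkl
    have hpt : ∀ w, ‖w - v‖ ^ (-((n:ℝ)-1)) ≤ 2 ^ n * k w := by
      intro w
      have h1 := hkl w
      have h2 : (2:ℝ) ^ (-(n:ℝ)) ≤ (2:ℝ) ^ (-((n:ℝ)-1)) :=
        Real.rpow_le_rpow_of_exponent_le (by norm_num) (by linarith)
      rw [Real.rpow_neg (by norm_num), Real.rpow_natCast] at h2
      have h3 : ((2:ℝ) ^ n)⁻¹ * ‖w - v‖ ^ (-((n:ℝ)-1)) ≤ k w := le_trans (by gcongr) h1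
      rwa [inv_mul_le_iff₀ (by positivity)] at h3
    have hi : IntegrableOn (fun w => g w * ‖w - v‖ ^ (-((n:ℝ)-1))) (ball p (2 * r)) := by
      refine Integrable.mono' ((gk k hk).const_mul (2 ^ n)) ?_ ?_
      · exact hgm.mul (Measurable.aestronglyMeasurable (by fun_prop))
      · refine .of_forall fun w => ?_
        rw [Real.norm_of_nonneg (by positivity)]
        calc g w * ‖w - v‖ ^ (-((n:ℝ)-1)) ≤ g w * (2 ^ n * k w) := by
              gcongr
              exact hpt w
          _ = _ := by ring
    refine ⟨hi, ?_⟩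
    rw [← integral_const_mul]
    apply integral_mono hi ((gk k hk).const_mul (2 ^ n))
    intro w
    calc g w * ‖w - v‖ ^ (-((n:ℝ)-1)) ≤ g w * (2 ^ n * k w) := by
          gcongr
          exact hpt w
      _ = _ := by ring
  obtain ⟨ix, cx⟩ := cmp kx x hkxi hkxl
  obtain ⟨iy, cy⟩ := cmp ky y hkyi hkyl
  have hdiff := aux_diff n hn r hr p x y hx hy b hb ix iy
  rw [← hσ] at hdiff
  set Jx := ∫ w in ball p (2 * r), g w * kx w
  set Jy := ∫ w in ball p (2 * r), g w * ky w
  have hsum : σ * ‖b x - b y‖ ≤ 4 ^ n * (Jx + Jy) := by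
    refine hdiff.trans ?_
    calc _ ≤ (2:ℝ) ^ n * (2 ^ n * Jx + 2 ^ n * Jy) := by gcongr
      _ = _ := by
          rw [← mul_add, ← mul_assoc, ← mul_pow]
          norm_num
  have h4 : (0:ℝ) < 4 ^ n := by positivity
  rcases le_total Jy Jx with h | h
  · exact half kx hkx hkx0 hkxi hkxM (hkxα α hα hαn) (hsum.trans (by nlinarith))
  · exact half ky hky hky0 hkyi hkyM (hkyα α hα hαn) (hsum.trans (by nlinarith))

lemma aux_fin (a A A' d N N' e f : ℝ) (ha : 0 ≤ a) (hA : 0 ≤ A) (hd : 0 ≤ d) (hN : 0 ≤ N)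
    (hAA : A ≤ A') (hNN : N ≤ N') (he : 0 ≤ e) (hf : 0 ≤ f) :
    a * A ^ e * d * N ^ f ≤ a * A' ^ e * d * N' ^ f := by
  have hA' : 0 ≤ A' := hA.trans hAA
  gcongr

theorem stmt_3 (n : ℕ) (hn : 2 ≤ n) :
    ∃ κ : ℝ, 0 < κ ∧
      ∀ (Φ : ℝ → ℝ), ConvexOn ℝ (Set.Ici 0) Φ → MonotoneOn Φ (Set.Ici 0) →
        (∀ t : ℝ, 0 ≤ t → 0 ≤ Φ t) →
      ∀ (o : EuclideanSpace ℝ (Fin n)) (R : ℝ), 0 < R →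
      ∀ α : ℝ, α ∈ Set.Ioo (1 : ℝ) ((n : ℝ) / ((n : ℝ) - 1)) →
      ∀ (U : Set (EuclideanSpace ℝ (Fin n))), IsOpen U → closedBall o (2 * R) ⊆ U →
      ∀ (b : EuclideanSpace ℝ (Fin n) → EuclideanSpace ℝ (Fin n)), ContDiffOn ℝ 1 b U →
      ∀ x ∈ ball o R, ∀ y ∈ ball o R, x ≠ y →
      Φ (‖b x - b y‖ / ‖x - y‖) ≤
        (1 / ((n : ℝ) * (volume (ball (0 : EuclideanSpace ℝ (Fin n)) 1)).toReal)) *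
        (∫ z in ball (0 : EuclideanSpace ℝ (Fin n)) (2 * R),
            ‖z‖ ^ (-(α * ((n : ℝ) - 1)))) ^ (1 / α) *
        (1 / ‖x - y‖) *
        (∫ z in ball o (2 * R), (Φ (κ * ‖fderiv ℝ b z‖)) ^ (α / (α - 1))) ^ ((α - 1) / α) := by
  refine ⟨8 * 4 ^ n, by positivity, ?_⟩
  intro Φ hΦ hmon hpos o R hR α hα U hU hUs b hb x hx y hy hxy
  have hn1 : 1 ≤ n := by omega
  have hn' : (2:ℝ) ≤ n := by exact_mod_cast hn
  have hα1 := hα.1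
  have hαn : α * ((n:ℝ)-1) < n := by
    have := hα.2
    rwa [lt_div_iff₀ (by linarith)] at this
  have hcont : ContinuousOn (fderiv ℝ b) U := hb.continuousOn_fderiv_of_isOpen hU le_rfl
  obtain ⟨B, hB⟩ := (isCompact_closedBall o (2 * R)).exists_bound_of_continuousOn
    (hcont.mono hUs)
  have hbE : ContDiffOn ℝ 1 b (ball o (2 * R)) := hb.mono (ball_subset_closedBall.trans hUs)
  have hBE : ∀ w ∈ ball o (2 * R), ‖fderiv ℝ b w‖ ≤ B := fun w hw =>
    hB w (ball_subset_closedBall hw)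
  by_cases hd : R / 2 ≤ ‖x - y‖
  · exact aux_core n hn1 Φ hΦ hmon hpos α hα1 hαn R hR o b hbE B hBE x y hx hy hd
  push Not at hd
  have hd0 : 0 < ‖x - y‖ := norm_pos_iff.2 (sub_ne_zero.2 hxy)
  obtain ⟨r, hr⟩ : ∃ r, r = ‖x - y‖ := ⟨_, rfl⟩
  obtain ⟨m, hm⟩ : ∃ m, m = midpoint ℝ x y := ⟨_, rfl⟩
  rw [← hr] at hd hd0
  have hmo : m ∈ ball o R := hm ▸ (convex_ball o R).midpoint_mem hx hy
  have hsub : ball m (2 * r) ⊆ ball o (2 * R) := by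
    apply ball_subset_ball'
    have := mem_ball.1 hmo
    linarith
  have hsub0 : ball (0 : EuclideanSpace ℝ (Fin n)) (2 * r) ⊆ ball 0 (2 * R) :=
    ball_subset_ball (by linarith)
  have hxm : x ∈ ball m r := by
    rw [mem_ball, hm, dist_left_midpoint, dist_eq_norm, ← hr, Real.norm_of_nonneg (by norm_num)]
    linarith
  have hym : y ∈ ball m r := by
    rw [mem_ball, hm, dist_right_midpoint, dist_eq_norm, ← hr, Real.norm_of_nonneg (by norm_num)]
    linarith
  have core := aux_core n hn1 Φ hΦ hmon hpos α hα1 hαn r hd0 m b (hbE.mono hsub) B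
    (fun w hw => hBE w (hsub hw)) x y hxm hym (by linarith)
  refine core.trans ?_
  have hfin : IsFiniteMeasure (volume.restrict (ball o (2 * R))) :=
    ⟨by simpa using measure_ball_lt_top⟩
  have hint := (aux_JH (volume.restrict (ball o (2 * R))) Φ hΦ hmon hpos α hα1 (fun _ => 1)
      (fun w => 8 * 4 ^ n * ‖fderiv ℝ b w‖) (by fun_prop) (by simp) (integrable_const _)
      (by
        simp only [integral_const, smul_eq_mul, mul_one, Measure.real, Measure.restrict_apply_univ]
        exact ENNReal.toReal_pos (measure_ball_pos _ _ (by positivity)).ne' measure_ball_lt_top.ne)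
      (by simp)
      (((hcont.mono (ball_subset_closedBall.trans hUs)).norm.aestronglyMeasurable
        measurableSet_ball).const_mul _) (fun w => by positivity) (8 * 4 ^ n * B) (by
        filter_upwards [ae_restrict_mem measurableSet_ball] with w hw
        have := hBE w hw
        gcongr)).2
  have hnn : ∀ w, 0 ≤ Φ (8 * 4 ^ n * ‖fderiv ℝ b w‖) ^ (α / (α - 1)) := fun w =>
    Real.rpow_nonneg (hpos _ (by positivity)) _
  have hA : ∫ z in ball (0 : EuclideanSpace ℝ (Fin n)) (2 * r), ‖z‖ ^ (-(α * ((n : ℝ) - 1))) ≤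
      ∫ z in ball (0 : EuclideanSpace ℝ (Fin n)) (2 * R), ‖z‖ ^ (-(α * ((n : ℝ) - 1))) :=
    setIntegral_mono_set (aux_intble n hn1 _ _ hαn) (.of_forall fun z => by simp; positivity)
      hsub0.eventuallyLE
  have hN : ∫ z in ball m (2 * r), (Φ (8 * 4 ^ n * ‖fderiv ℝ b z‖)) ^ (α / (α - 1)) ≤
      ∫ z in ball o (2 * R), (Φ (8 * 4 ^ n * ‖fderiv ℝ b z‖)) ^ (α / (α - 1)) :=
    setIntegral_mono_set hint (.of_forall hnn) hsub.eventuallyLE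
  have hN0 : 0 ≤ ∫ z in ball m (2 * r), (Φ (8 * 4 ^ n * ‖fderiv ℝ b z‖)) ^ (α / (α - 1)) :=
    integral_nonneg hnn
  have hα0 : 0 ≤ (α - 1) / α := div_nonneg (by linarith) (by linarith)
  exact aux_fin _ _ _ _ _ _ _ _ (by positivity)
    (integral_nonneg fun z => Real.rpow_nonneg (norm_nonneg _) _) (by positivity) hN0 hA hN
    (by positivity) hα0
end

section
/- Let n ≥ 1, ℓ > 0, p > n, and let Ω ⊂ ℝ^n be a bounded open set. Let b: [0,ℓ] × ℝ^n → ℝ^n be a bounded continuous vector field such that the spatial differential D_xb(t,x) exists at every point and is continuous on [0,ℓ] × ℝ^n, and such that b(t,x) = 0 whenever x ∉ Ω, for every t ∈ [0,ℓ]. Let X: [0,ℓ] × [0,ℓ] × ℝ^n → ℝ^n be the flow of b, i.e. X(s,s,x) = x and ∂_t X(t,s,x) = b(t, X(t,s,x)) for all s, t ∈ [0,ℓ] and x ∈ ℝ^n. Then for all s, t ∈ [0,ℓ], the map x ↦ X(t,s,x) is C¹ and ∫_Ω ‖D_x X(t,s,x)‖^p dx ≤ (1/ℓ) ∫_0^ℓ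 ∫_Ω exp( (ℓ p² / (p−n)) ‖D_x b(v,y)‖ ) dy dv. -/
open MeasureTheory Metric

section Gron
variable {F : Type*} [NormedAddCommGroup F] [NormedSpace ℝ F]

lemma gron_fwd {ℓ s δ ε η : ℝ} {a : ℝ → ℝ} (ha : Continuous a)
    (ha0 : ∀ t, 0 ≤ a t) {f f' : ℝ → F} (hs : 0 ≤ s)
    (hf : ∀ t ∈ Set.Icc 0 ℓ, HasDerivWithinAt f (f' t) (Set.Icc 0 ℓ) t)
    (hb : ∀ t ∈ Set.Icc 0 ℓ, ‖f' t‖ ≤ a t * ‖f t‖ + ε)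
    (hfs : ‖f s‖ ≤ δ) (hη : 0 < η) (hε : ε < η * δ) (hδ : 0 < δ) :
    ∀ t ∈ Set.Icc s ℓ, ‖f t‖ ≤ δ * Real.exp ((∫ v in s..t, a v) + η * (t - s)) := by
  have hd : ∀ x, HasDerivAt (fun t => δ * Real.exp ((∫ v in s..t, a v) + η * (t - s)))
      (δ * (Real.exp ((∫ v in s..x, a v) + η * (x - s)) * (a x + η * 1))) x := by
    intro x
    have h1 : HasDerivAt (fun t => ∫ v in s..t, a v) (a x) x :=
      intervalIntegral.integral_hasDerivAt_right (ha.intervalIntegrable _ _)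
        (ha.stronglyMeasurableAtFilter _ _) ha.continuousAt
    exact ((h1.add (((hasDerivAt_id x).sub_const s).const_mul η)).exp).const_mul δ
  intro t ht
  refine image_norm_le_of_norm_deriv_right_lt_deriv_boundary' (f := f) (f' := f') (a := s) (b := ℓ)
    (fun t ht => ((hf t ⟨hs.trans ht.1, ht.2⟩).continuousWithinAt.mono
      (Set.Icc_subset_Icc_left hs))) ?_ ?_
    (fun x _ => (hd x).continuousAt.continuousWithinAt)
    (fun x _ => (hd x).hasDerivWithinAt) ?_ ht
  · intro x hx
    have := (hf x ⟨hs.trans hx.1, hx.2.le⟩)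
    refine this.mono_of_mem_nhdsWithin ?_
    refine Filter.mem_of_superset (Icc_mem_nhdsGE hx.2) (Set.Icc_subset_Icc_left (hs.trans hx.1))
  · simpa using hfs
  · intro x hx hxe
    have h1 := hb x ⟨hs.trans hx.1, hx.2.le⟩
    rw [hxe] at h1
    have h2 : 1 ≤ Real.exp ((∫ v in s..x, a v) + η * (x - s)) := by
      apply Real.one_le_exp
      have := intervalIntegral.integral_nonneg (μ := volume) hx.1 (fun u _ => ha0 u)
      have := mul_nonneg hη.le (sub_nonneg.2 hx.1)
      linarith
    have h3 : η * δ * 1 ≤ η * δ * Real.exp ((∫ v in s..x, a v) + η * (x - s)) := by gcongr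
    nlinarith

lemma gron {ℓ s δ ε η : ℝ} {a : ℝ → ℝ} (ha : Continuous a)
    (ha0 : ∀ t, 0 ≤ a t) {f f' : ℝ → F} (hs : s ∈ Set.Icc 0 ℓ)
    (hf : ∀ t ∈ Set.Icc 0 ℓ, HasDerivWithinAt f (f' t) (Set.Icc 0 ℓ) t)
    (hb : ∀ t ∈ Set.Icc 0 ℓ, ‖f' t‖ ≤ a t * ‖f t‖ + ε)
    (hfs : ‖f s‖ ≤ δ) (hη : 0 < η) (hε : ε < η * δ) (hδ : 0 < δ) :
    ∀ t ∈ Set.Icc 0 ℓ, ‖f t‖ ≤ δ * Real.exp ((∫ v in (0:ℝ)..ℓ, a v) + η * ℓ) := by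
  have hmono : ∀ x y, 0 ≤ x → x ≤ y → y ≤ ℓ → ∫ v in x..y, a v ≤ ∫ v in (0:ℝ)..ℓ, a v := by
    intro x y h0 h1 h2
    exact intervalIntegral.integral_mono_interval h0 h1 h2 (Filter.Eventually.of_forall ha0)
      (ha.intervalIntegrable _ _)
  intro t ht
  rcases le_total s t with hst | hst
  · refine (gron_fwd ha ha0 hs.1 hf hb hfs hη hε hδ t ⟨hst, ht.2⟩).trans ?_
    have := hmono s t hs.1 hst ht.2
    gcongr
    linarith [hs.1, ht.2]
  · have hr : ∀ τ ∈ Set.Icc 0 ℓ, ℓ - τ ∈ Set.Icc 0 ℓ := fun τ hτ =>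
      ⟨by linarith [hτ.2], by linarith [hτ.1]⟩
    have key := gron_fwd (ℓ := ℓ) (s := ℓ - s) (δ := δ) (ε := ε) (η := η) (a := fun τ => a (ℓ - τ))
      (f := fun τ => f (ℓ - τ)) (f' := fun τ => - f' (ℓ - τ)) (by fun_prop) (fun _ => ha0 _)
      (by linarith [hs.2]) ?_ ?_ (by simpa using hfs) hη hε hδ (ℓ - t)
      ⟨by linarith, by linarith [ht.1]⟩
    · simp only [sub_sub_cancel] at key
      refine key.trans ?_
      rw [intervalIntegral.integral_comp_sub_left]
      simp only [sub_sub_cancel]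
      have := hmono t s ht.1 hst hs.2
      gcongr
      linarith [hs.2, ht.1]
    · intro τ hτ
      have h1 := hf _ (hr τ hτ)
      have h2 : HasDerivWithinAt (fun τ : ℝ => ℓ - τ) (-1) (Set.Icc 0 ℓ) τ := by
        simpa using (hasDerivWithinAt_id τ (Set.Icc 0 ℓ)).const_sub ℓ
      have h3 := h1.scomp τ h2 hr
      rw [neg_one_smul] at h3
      exact h3
    · intro τ hτ
      rw [norm_neg]
      exact hb _ (hr τ hτ)

lemma gron0 {ℓ s : ℝ} {a : ℝ → ℝ} (ha : Continuous a)
    (ha0 : ∀ t, 0 ≤ a t) {f f' : ℝ → F} (hs : s ∈ Set.Icc 0 ℓ)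
    (hf : ∀ t ∈ Set.Icc 0 ℓ, HasDerivWithinAt f (f' t) (Set.Icc 0 ℓ) t)
    (hb : ∀ t ∈ Set.Icc 0 ℓ, ‖f' t‖ ≤ a t * ‖f t‖) :
    ∀ t ∈ Set.Icc 0 ℓ, ‖f t‖ ≤ ‖f s‖ * Real.exp (∫ v in (0:ℝ)..ℓ, a v) := by
  intro t ht
  have hc : ContinuousWithinAt (fun η : ℝ => (‖f s‖ + η) * Real.exp ((∫ v in (0:ℝ)..ℓ, a v) + η * ℓ))
      (Set.Ioi 0) 0 := by
    apply Continuous.continuousWithinAt; fun_prop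
  have := ge_of_tendsto (b := ‖f t‖) hc.tendsto ?_
  · simpa using this
  · filter_upwards [self_mem_nhdsWithin] with η hη
    have hη : 0 < η := hη
    have h0 := norm_nonneg (f s)
    exact gron (ε := 0) ha ha0 hs hf (by simpa using hb) (by linarith) hη (by positivity)
      (by positivity) t ht

lemma gron1 {ℓ s ε : ℝ} {a : ℝ → ℝ} (ha : Continuous a)
    (ha0 : ∀ t, 0 ≤ a t) {f f' : ℝ → F} (hs : s ∈ Set.Icc 0 ℓ)
    (hf : ∀ t ∈ Set.Icc 0 ℓ, HasDerivWithinAt f (f' t) (Set.Icc 0 ℓ) t)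
    (hb : ∀ t ∈ Set.Icc 0 ℓ, ‖f' t‖ ≤ a t * ‖f t‖ + ε) (hfs : f s = 0) (hε : 0 ≤ ε) :
    ∀ t ∈ Set.Icc 0 ℓ, ‖f t‖ ≤ ε * Real.exp ((∫ v in (0:ℝ)..ℓ, a v) + ℓ) := by
  intro t ht
  have hc : ContinuousWithinAt (fun η : ℝ => (ε + η) * Real.exp ((∫ v in (0:ℝ)..ℓ, a v) + 1 * ℓ))
      (Set.Ioi 0) 0 := by
    apply Continuous.continuousWithinAt; fun_prop
  have := ge_of_tendsto (b := ‖f t‖) hc.tendsto ?_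
  · simpa using this
  · filter_upwards [self_mem_nhdsWithin] with η hη
    have hη : 0 < η := hη
    exact gron (ε := ε) ha ha0 hs hf hb (by simp [hfs]; linarith) one_pos (by linarith)
      (by positivity) t ht
end Gron

section Lin
variable {E : Type*} [NormedAddCommGroup E] [NormedSpace ℝ E] [FiniteDimensional ℝ E]

lemma linear_exists {ℓ s K : ℝ} (hs : s ∈ Set.Icc 0 ℓ) {A : ℝ → (E →L[ℝ] E)}
    (hA : Continuous A) (hK : ∀ t, ‖A t‖ ≤ K) :
    ∃ Y : ℝ → (E →L[ℝ] E), Y s = 1 ∧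
      ∀ t ∈ Set.Icc 0 ℓ, HasDerivWithinAt Y ((A t).comp (Y t)) (Set.Icc 0 ℓ) t := by
  have hK0 : 0 ≤ K := (norm_nonneg _).trans (hK 0)
  have hℓ : 0 ≤ ℓ := hs.1.trans hs.2
  set R : ℝ := (‖(1 : E →L[ℝ] E)‖ + 1) * Real.exp (K * ℓ) with hR
  have hRpos : 0 < R := by positivity
  let χ : ContDiffBump (0 : E →L[ℝ] E) := ⟨R, 2 * R, hRpos, by linarith⟩
  let ρ : (E →L[ℝ] E) → (E →L[ℝ] E) := fun Y => χ Y • Y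
  have hρ1 : ContDiff ℝ 1 ρ := (χ.contDiff).smul contDiff_id
  have hρ2 : HasCompactSupport ρ := χ.hasCompactSupport.smul_right
  obtain ⟨C, hC⟩ := hρ1.lipschitzWith_of_hasCompactSupport hρ2 (by simp)
  have hρn : ∀ Y, ‖ρ Y‖ ≤ 2 * R := by
    intro Y
    by_cases h : Y ∈ ball (0 : E →L[ℝ] E) (2 * R)
    · have h1 : ‖Y‖ ≤ 2 * R := by simpa using (mem_ball_zero_iff.1 h).le
      calc ‖ρ Y‖ = χ Y * ‖Y‖ := by simp [ρ, norm_smul, abs_of_nonneg χ.nonneg]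
        _ ≤ 1 * (2 * R) := by gcongr; exact χ.le_one
        _ = _ := one_mul _
    · have : χ Y = 0 := by
        apply Function.notMem_support.1
        rw [χ.support_eq]; exact h
      simp [ρ, this]; positivity
  have hρl : ∀ Y, ‖ρ Y‖ ≤ ‖Y‖ := by
    intro Y
    calc ‖ρ Y‖ = χ Y * ‖Y‖ := by simp [ρ, norm_smul, abs_of_nonneg χ.nonneg]
        _ ≤ 1 * ‖Y‖ := by gcongr; exact χ.le_one
        _ = _ := one_mul _
  have hρi : ∀ Y, ‖Y‖ ≤ R → ρ Y = Y := by
    intro Y hY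
    have : χ Y = 1 := χ.one_of_mem_closedBall (by simpa using hY)
    simp [ρ, this]
  let Kn : NNReal := ⟨K, hK0⟩
  let Rn : NNReal := ⟨R, hRpos.le⟩
  let ln : NNReal := ⟨ℓ, hℓ⟩
  have hpl : IsPicardLindelof (fun t Y => (A t).comp (ρ Y)) (⟨s, hs⟩ : Set.Icc 0 ℓ) (1 : E →L[ℝ] E)
      (Kn * (2 * Rn) * ln) 0 (Kn * (2 * Rn)) (Kn * C) := by
    refine ⟨?_, ?_, ?_, ?_⟩
    · intro t _
      apply LipschitzWith.lipschitzOnWith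
      refine LipschitzWith.of_dist_le_mul fun Y Z => ?_
      rw [dist_eq_norm, ← ContinuousLinearMap.comp_sub]
      refine (ContinuousLinearMap.opNorm_comp_le _ _).trans ?_
      have := hC.dist_le_mul Y Z
      rw [dist_eq_norm] at this
      calc _ ≤ K * (C * dist Y Z) := by gcongr; exact hK t
        _ = K * C * dist Y Z := by ring
    · intro Y _
      exact (hA.clm_comp continuous_const).continuousOn
    · intro t _ Y _
      refine (ContinuousLinearMap.opNorm_comp_le _ _).trans ?_
      have h : ‖A t‖ * ‖ρ Y‖ ≤ K * (2 * R) := by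
        gcongr
        exacts [hK t, hρn Y]
      exact h
    · have : max (ℓ - s) (s - 0) ≤ ℓ := max_le (by linarith [hs.1]) (by linarith [hs.2])
      simp only [NNReal.coe_mul, NNReal.coe_zero, sub_zero]
      gcongr
      rw [sub_zero] at this
      exact this
  obtain ⟨Y, hY0, hY⟩ := hpl.exists_eq_forall_mem_Icc_hasDerivWithinAt₀
  refine ⟨Y, hY0, fun t ht => ?_⟩
  have hbd : ∀ t ∈ Set.Icc 0 ℓ, ‖Y t‖ ≤ R := by
    intro t ht
    have := gron0 (a := fun _ => K) continuous_const (fun _ => hK0) hs hY (fun t _ => by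
      refine (ContinuousLinearMap.opNorm_comp_le _ _).trans ?_
      gcongr
      exacts [hK t, hρl _]) t ht
    refine this.trans ?_
    simp only [] at hY0
    rw [hY0, hR]
    simp only [intervalIntegral.integral_const, sub_zero, smul_eq_mul]
    rw [mul_comm ℓ K]
    gcongr
    linarith
  simpa [hρi _ (hbd t ht)] using hY t ht
end Lin

structure FlowSetup {E : Type*} [NormedAddCommGroup E] [NormedSpace ℝ E]
    (ℓ K : ℝ) (Ω : Set E) (b : ℝ → E → E) (D : ℝ → E → (E →L[ℝ] E)) (X : ℝ → ℝ → E → E) :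
    Prop where
  hℓ : 0 < ℓ
  hΩo : IsOpen Ω
  hΩb : Bornology.IsBounded Ω
  hD : Continuous (fun q : ℝ × E => D q.1 q.2)
  hd : ∀ t x, HasFDerivAt (b t) (D t x) x
  hK : ∀ t x, ‖D t x‖ ≤ K
  hs : ∀ t x, x ∉ Ω → b t x = 0
  start : ∀ s ∈ Set.Icc (0:ℝ) ℓ, ∀ x, X s s x = x
  ode : ∀ s ∈ Set.Icc (0:ℝ) ℓ, ∀ t ∈ Set.Icc (0:ℝ) ℓ, ∀ x,
      HasDerivWithinAt (fun τ => X τ s x) (b t (X t s x)) (Set.Icc (0:ℝ) ℓ) t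

namespace FlowSetup
variable {E : Type*} [NormedAddCommGroup E] [NormedSpace ℝ E]
  {ℓ K : ℝ} {Ω : Set E} {b : ℝ → E → E} {D : ℝ → E → (E →L[ℝ] E)} {X : ℝ → ℝ → E → E}

lemma K0 (h : FlowSetup ℓ K Ω b D X) : 0 ≤ K := (norm_nonneg _).trans (h.hK 0 0)

lemma lip (h : FlowSetup ℓ K Ω b D X) (t : ℝ) (x y : E) : ‖b t x - b t y‖ ≤ K * ‖x - y‖ :=
  Convex.norm_image_sub_le_of_norm_hasFDerivWithin_le
    (fun z _ => (h.hd t z).hasFDerivWithinAt) (fun z _ => h.hK t z) convex_univ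
    (Set.mem_univ y) (Set.mem_univ x)

lemma sol_dist (h : FlowSetup ℓ K Ω b D X) {γ₁ γ₂ : ℝ → E}
    (h1 : ∀ t ∈ Set.Icc 0 ℓ, HasDerivWithinAt γ₁ (b t (γ₁ t)) (Set.Icc 0 ℓ) t)
    (h2 : ∀ t ∈ Set.Icc 0 ℓ, HasDerivWithinAt γ₂ (b t (γ₂ t)) (Set.Icc 0 ℓ) t)
    {s t : ℝ} (hs : s ∈ Set.Icc 0 ℓ) (ht : t ∈ Set.Icc 0 ℓ) :
    ‖γ₁ t - γ₂ t‖ ≤ Real.exp (K * ℓ) * ‖γ₁ s - γ₂ s‖ := by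
  have := gron0 (a := fun _ => K) (f := fun t => γ₁ t - γ₂ t) continuous_const (fun _ => h.K0) hs
    (fun t ht => (h1 t ht).sub (h2 t ht)) (fun t ht => h.lip _ _ _) t ht
  simp only [intervalIntegral.integral_const, sub_zero, smul_eq_mul] at this
  rw [mul_comm ℓ K, mul_comm] at this
  exact this

lemma X_lip (h : FlowSetup ℓ K Ω b D X) {s t : ℝ} (hs : s ∈ Set.Icc 0 ℓ) (ht : t ∈ Set.Icc 0 ℓ)
    (x y : E) : ‖X t s x - X t s y‖ ≤ Real.exp (K * ℓ) * ‖x - y‖ := by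
  have := h.sol_dist (γ₁ := fun τ => X τ s x) (γ₂ := fun τ => X τ s y)
    (fun t ht => h.ode s hs t ht x) (fun t ht => h.ode s hs t ht y) hs ht
  simpa [h.start s hs] using this

lemma X_comp (h : FlowSetup ℓ K Ω b D X) {r s t : ℝ} (hr : r ∈ Set.Icc 0 ℓ)
    (hs : s ∈ Set.Icc 0 ℓ) (ht : t ∈ Set.Icc 0 ℓ)
    (x : E) : X t r (X r s x) = X t s x := by
  have := h.sol_dist (γ₁ := fun τ => X τ r (X r s x)) (γ₂ := fun τ => X τ s x)
    (fun t ht => h.ode r hr t ht _) (fun t ht => h.ode s hs t ht x) hr ht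
  simp only [h.start r hr, sub_self, norm_zero, mul_zero] at this
  exact sub_eq_zero.1 (norm_le_zero_iff.1 this)

lemma X_inv (h : FlowSetup ℓ K Ω b D X) {s t : ℝ}
    (hs : s ∈ Set.Icc 0 ℓ) (ht : t ∈ Set.Icc 0 ℓ)
    (x : E) : X s t (X t s x) = x := by
  rw [h.X_comp ht hs hs, h.start s hs]

lemma X_out (h : FlowSetup ℓ K Ω b D X) {s t : ℝ}
    (hs : s ∈ Set.Icc 0 ℓ) (ht : t ∈ Set.Icc 0 ℓ)
    {x : E} (hx : x ∉ Ω) : X t s x = x := by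
  have := h.sol_dist (γ₁ := fun τ => X τ s x) (γ₂ := fun τ => x)
    (fun t ht => h.ode s hs t ht _) (fun t ht => by
      rw [h.hs t x hx]; exact hasDerivWithinAt_const _ _ _) hs ht
  simp only [h.start s hs, sub_self, norm_zero, mul_zero] at this
  exact sub_eq_zero.1 (norm_le_zero_iff.1 this)

lemma X_mem (h : FlowSetup ℓ K Ω b D X) {s t : ℝ}
    (hs : s ∈ Set.Icc 0 ℓ) (ht : t ∈ Set.Icc 0 ℓ)
    {x : E} (hx : x ∈ Ω) : X t s x ∈ Ω := by
  by_contra hc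
  have h1 := h.X_out ht hs hc
  rw [h.X_inv hs ht] at h1
  rw [← h1] at hc
  exact hc hx

lemma X_image (h : FlowSetup ℓ K Ω b D X) {s t : ℝ}
    (hs : s ∈ Set.Icc 0 ℓ) (ht : t ∈ Set.Icc 0 ℓ) : X t s '' Ω = Ω := by
  ext y
  constructor
  · rintro ⟨x, hx, rfl⟩
    exact h.X_mem hs ht hx
  · intro hy
    exact ⟨X s t y, h.X_mem ht hs hy, h.X_inv ht hs y⟩

/-- time-extended trajectories -/
noncomputable def ext (_ : FlowSetup ℓ K Ω b D X) (s t : ℝ) (x : E) : E :=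
  X (max 0 (min ℓ t)) s x

lemma proj_mem (h : FlowSetup ℓ K Ω b D X) (t : ℝ) : max 0 (min ℓ t) ∈ Set.Icc 0 ℓ :=
  ⟨le_max_left _ _, max_le h.hℓ.le (min_le_left _ _)⟩

lemma ext_eq (h : FlowSetup ℓ K Ω b D X) {s t : ℝ} (ht : t ∈ Set.Icc 0 ℓ) (x : E) :
    h.ext s t x = X t s x := by
  rw [ext, min_eq_right ht.2, max_eq_right ht.1]

lemma ext_cont_time (h : FlowSetup ℓ K Ω b D X) {s : ℝ} (hs : s ∈ Set.Icc 0 ℓ) (x : E) :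
    Continuous (fun t => h.ext s t x) := by
  have h1 : ContinuousOn (fun τ => X τ s x) (Set.Icc 0 ℓ) := fun t ht =>
    (h.ode s hs t ht x).continuousWithinAt
  exact h1.comp_continuous (f := fun t => max 0 (min ℓ t)) (by fun_prop) h.proj_mem

lemma ext_cont (h : FlowSetup ℓ K Ω b D X) {s : ℝ} (hs : s ∈ Set.Icc 0 ℓ) :
    Continuous (fun q : ℝ × E => h.ext s q.1 q.2) := by
  refine continuous_prod_of_continuous_lipschitzWith' (K := ⟨Real.exp (K * ℓ), by positivity⟩) _ ?_ ?_
  · intro t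
    refine LipschitzWith.of_dist_le_mul fun x y => ?_
    rw [dist_eq_norm, dist_eq_norm]
    exact h.X_lip hs (h.proj_mem t) x y
  · exact h.ext_cont_time hs

lemma unif (h : FlowSetup ℓ K Ω b D X) {s : ℝ} (hs : s ∈ Set.Icc 0 ℓ) (x : E) {ε : ℝ} (hε : 0 < ε) :
    ∃ δ > 0, ∀ t ∈ Set.Icc 0 ℓ, ∀ z, ‖z - X t s x‖ < δ → ‖D t z - D t (X t s x)‖ < ε := by
  have hc : IsCompact ((fun t => (t, h.ext s t x)) '' Set.Icc 0 ℓ) :=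
    isCompact_Icc.image (continuous_id.prodMk (h.ext_cont_time hs x))
  have := hc.uniformContinuousAt_of_continuousAt (fun q : ℝ × E => D q.1 q.2)
    (fun q _ => h.hD.continuousAt) (dist_mem_uniformity hε)
  obtain ⟨δ, hδ, H⟩ := mem_uniformity_dist.1 this
  refine ⟨δ, hδ, fun t ht z hz => ?_⟩
  have := @H (t, X t s x) (t, z) ?_ ⟨t, ht, by simp [h.ext_eq ht]⟩
  · rw [← dist_eq_norm, dist_comm]
    exact this
  · rw [Prod.dist_eq]
    simp [hδ, dist_comm (X t s x) z, dist_eq_norm, hz]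

variable [FiniteDimensional ℝ E]

/-- derivative data at x -/
lemma exists_deriv (h : FlowSetup ℓ K Ω b D X) {s : ℝ} (hs : s ∈ Set.Icc 0 ℓ) (x : E) :
    ∃ Y : ℝ → (E →L[ℝ] E), Y s = 1 ∧
      ∀ t ∈ Set.Icc 0 ℓ, HasDerivWithinAt Y ((D t (X t s x)).comp (Y t)) (Set.Icc 0 ℓ) t := by
  obtain ⟨Y, h0, hY⟩ := linear_exists (A := fun t => D t (h.ext s t x)) hs
    (h.hD.comp (continuous_id.prodMk (h.ext_cont_time hs x))) (fun t => h.hK _ _)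
  refine ⟨Y, h0, fun t ht => ?_⟩
  have := hY t ht
  rwa [h.ext_eq ht] at this

noncomputable def J (h : FlowSetup ℓ K Ω b D X) {s : ℝ} (hs : s ∈ Set.Icc 0 ℓ) (t : ℝ) (x : E) :
    E →L[ℝ] E := (h.exists_deriv hs x).choose t

lemma J_init (h : FlowSetup ℓ K Ω b D X) {s : ℝ} (hs : s ∈ Set.Icc 0 ℓ) (x : E) :
    h.J hs s x = 1 := (h.exists_deriv hs x).choose_spec.1

lemma J_ode (h : FlowSetup ℓ K Ω b D X) {s : ℝ} (hs : s ∈ Set.Icc 0 ℓ) (x : E) :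
    ∀ t ∈ Set.Icc 0 ℓ, HasDerivWithinAt (fun t => h.J hs t x)
      ((D t (X t s x)).comp (h.J hs t x)) (Set.Icc 0 ℓ) t :=
  (h.exists_deriv hs x).choose_spec.2

lemma J_bound (h : FlowSetup ℓ K Ω b D X) {s t : ℝ} (hs : s ∈ Set.Icc 0 ℓ) (ht : t ∈ Set.Icc 0 ℓ)
    (x : E) :
    ‖h.J hs t x‖ ≤ Real.exp (∫ v in (0:ℝ)..ℓ, ‖D v (h.ext s v x)‖) := by
  have := gron0 (a := fun v => ‖D v (h.ext s v x)‖)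
    (h.hD.comp (continuous_id.prodMk (h.ext_cont_time hs x))).norm (fun _ => norm_nonneg _) hs
    (h.J_ode hs x) (fun t ht => by
      rw [h.ext_eq ht]
      exact ContinuousLinearMap.opNorm_comp_le _ _) t ht
  refine this.trans ?_
  rw [h.J_init]
  refine mul_le_of_le_one_left (by positivity) ContinuousLinearMap.norm_id_le

lemma J_bound' (h : FlowSetup ℓ K Ω b D X) {s t : ℝ} (hs : s ∈ Set.Icc 0 ℓ) (ht : t ∈ Set.Icc 0 ℓ)
    (x : E) : ‖h.J hs t x‖ ≤ Real.exp (K * ℓ) := by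
  refine (h.J_bound hs ht x).trans ?_
  gcongr
  have hc : Continuous fun v => ‖D v (h.ext s v x)‖ :=
    (h.hD.comp (continuous_id.prodMk (h.ext_cont_time hs x))).norm
  calc _ ≤ ∫ v in (0:ℝ)..ℓ, K := intervalIntegral.integral_mono_on h.hℓ.le
        (hc.intervalIntegrable _ _) (by simp) (fun v _ => h.hK _ _)
    _ = K * ℓ := by simp [mul_comm]

lemma hasFDerivAt (h : FlowSetup ℓ K Ω b D X) {s t : ℝ} (hs : s ∈ Set.Icc 0 ℓ)
    (ht : t ∈ Set.Icc 0 ℓ) (x : E) : HasFDerivAt (X t s) (h.J hs t x) x := by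
  rw [hasFDerivAt_iff_isLittleO_nhds_zero, Asymptotics.isLittleO_iff]
  intro c hc
  set C := Real.exp (K * ℓ) with hC
  have hCpos : 0 < C := Real.exp_pos _
  set C' := Real.exp (ℓ * K + ℓ) with hC'
  have hC'pos : 0 < C' := Real.exp_pos _
  obtain ⟨δ, hδ, H⟩ := h.unif hs x (ε := c / (C * C')) (by positivity)
  filter_upwards [Metric.ball_mem_nhds (0 : E) (ε := δ / C) (by positivity)] with v hv
  have hv : ‖v‖ < δ / C := by simpa using hv
  have key := gron1 (a := fun _ => K) (ε := c / (C * C') * (C * ‖v‖)) (F := E) (s := s) (ℓ := ℓ)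
    (f := fun t => X t s (x + v) - X t s x - h.J hs t x v)
    (f' := fun t => b t (X t s (x + v)) - b t (X t s x) - (D t (X t s x)) (h.J hs t x v))
    continuous_const (fun _ => h.K0) hs ?_ ?_ ?_ (by positivity) t ht
  · refine key.trans (le_of_eq ?_)
    simp only [intervalIntegral.integral_const, sub_zero, smul_eq_mul]
    rw [← hC']
    field_simp
  · intro t ht
    exact ((h.ode s hs t ht (x+v)).sub (h.ode s hs t ht x)).sub
      ((h.J_ode hs x t ht).clm_apply (hasDerivWithinAt_const _ _ v) |>.congr_deriv (by simp))
  · intro t ht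
    have hlip := h.X_lip hs ht (x + v) x
    rw [add_sub_cancel_left] at hlip
    have hlt : ‖X t s (x + v) - X t s x‖ < δ := by
      refine hlip.trans_lt ?_
      rw [lt_div_iff₀ hCpos] at hv
      linarith
    have h1 := Convex.norm_image_sub_le_of_norm_hasFDerivWithin_le' (f := b t) (f' := D t)
      (φ := D t (X t s x)) (s := ball (X t s x) δ) (C := c / (C * C')) (x := X t s x)
      (y := X t s (x + v)) (fun z _ => (h.hd t z).hasFDerivWithinAt)
      (fun z hz => (H t ht z (by simpa [dist_eq_norm] using hz)).le) (convex_ball _ _)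
      (mem_ball_self hδ) (by simpa [dist_eq_norm] using hlt)
    have h2 : b t (X t s (x + v)) - b t (X t s x) - (D t (X t s x)) (h.J hs t x v) =
        (D t (X t s x)) (X t s (x + v) - X t s x - h.J hs t x v) +
        (b t (X t s (x + v)) - b t (X t s x) - (D t (X t s x)) (X t s (x + v) - X t s x)) := by
      simp only [map_sub]; abel
    rw [h2]
    refine (norm_add_le _ _).trans (add_le_add ?_ (h1.trans ?_))
    · exact (ContinuousLinearMap.le_opNorm _ _).trans (by gcongr; exact h.hK _ _)
    · gcongr
  · simp [h.start s hs, h.J_init]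

lemma J_cont (h : FlowSetup ℓ K Ω b D X) {s t : ℝ} (hs : s ∈ Set.Icc 0 ℓ)
    (ht : t ∈ Set.Icc 0 ℓ) : Continuous (h.J hs t) := by
  rw [Metric.continuous_iff]
  intro x c hc
  set C := Real.exp (K * ℓ) with hC
  have hCpos : 0 < C := Real.exp_pos _
  set C' := Real.exp (ℓ * K + ℓ) with hC'
  have hC'pos : 0 < C' := Real.exp_pos _
  obtain ⟨δ, hδ, H⟩ := h.unif hs x (ε := c / 2 / (C * C')) (by positivity)
  refine ⟨δ / C, by positivity, fun y hy => ?_⟩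
  rw [dist_eq_norm] at hy ⊢
  have key := gron1 (a := fun _ => K) (ε := c / 2 / (C * C') * C) (s := s) (ℓ := ℓ)
    (f := fun t => h.J hs t y - h.J hs t x)
    (f' := fun t => (D t (X t s y)).comp (h.J hs t y) - (D t (X t s x)).comp (h.J hs t x))
    continuous_const (fun _ => h.K0) hs ?_ ?_ ?_ (by positivity) t ht
  · refine key.trans_lt ?_
    simp only [intervalIntegral.integral_const, sub_zero, smul_eq_mul]
    rw [← hC']
    have : c / 2 / (C * C') * C * C' = c / 2 := by field_simp
    linarith
  · intro t ht
    exact (h.J_ode hs y t ht).sub (h.J_ode hs x t ht)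
  · intro t ht
    have hlt : ‖X t s y - X t s x‖ < δ := by
      refine (h.X_lip hs ht y x).trans_lt ?_
      rw [lt_div_iff₀ hCpos] at hy
      linarith
    have h2 : (D t (X t s y)).comp (h.J hs t y) - (D t (X t s x)).comp (h.J hs t x) =
        (D t (X t s y)).comp (h.J hs t y - h.J hs t x) +
        (D t (X t s y) - D t (X t s x)).comp (h.J hs t x) := by
      simp only [ContinuousLinearMap.comp_sub, ContinuousLinearMap.sub_comp]; abel
    rw [h2]
    refine (norm_add_le _ _).trans (add_le_add ?_ ?_)
    · exact (ContinuousLinearMap.opNorm_comp_le _ _).trans (by gcongr; exact h.hK _ _)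
    · refine (ContinuousLinearMap.opNorm_comp_le _ _).trans ?_
      gcongr
      · exact (H t ht _ hlt).le
      · exact h.J_bound' hs ht x
  · simp [h.J_init]

lemma contDiff (h : FlowSetup ℓ K Ω b D X) {s t : ℝ} (hs : s ∈ Set.Icc 0 ℓ)
    (ht : t ∈ Set.Icc 0 ℓ) : ContDiff ℝ 1 (X t s) := by
  rw [contDiff_one_iff_fderiv]
  refine ⟨fun x => (h.hasFDerivAt hs ht x).differentiableAt, ?_⟩
  have : fderiv ℝ (X t s) = h.J hs t := funext fun x => (h.hasFDerivAt hs ht x).fderiv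
  rw [this]
  exact h.J_cont hs ht

end FlowSetup

lemma abs_det_le_norm_pow {n : ℕ} (A : EuclideanSpace ℝ (Fin n) →L[ℝ] EuclideanSpace ℝ (Fin n)) :
    |A.det| ≤ ‖A‖ ^ n := by
  have h1 := Measure.addHaar_image_continuousLinearMap (volume : Measure (EuclideanSpace ℝ (Fin n)))
    A (closedBall 0 1)
  have h2 : A '' closedBall 0 1 ⊆ closedBall 0 ‖A‖ := by
    rintro _ ⟨x, hx, rfl⟩
    have hx : ‖x‖ ≤ 1 := by simpa using hx
    have : ‖A x‖ ≤ ‖A‖ := (A.le_opNorm x).trans (mul_le_of_le_one_right (norm_nonneg _) hx)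
    simpa using this
  have h3 := measure_mono (μ := volume) h2
  rw [h1, Measure.addHaar_closedBall' _ _ (norm_nonneg A), finrank_euclideanSpace_fin] at h3
  have hpos : volume (closedBall (0 : EuclideanSpace ℝ (Fin n)) 1) ≠ 0 :=
    (measure_closedBall_pos _ _ one_pos).ne'
  have hfin : volume (closedBall (0 : EuclideanSpace ℝ (Fin n)) 1) ≠ ⊤ :=
    measure_closedBall_lt_top.ne
  rw [ENNReal.mul_le_mul_iff_left hpos hfin] at h3
  exact (ENNReal.ofReal_le_ofReal_iff (by positivity)).1 h3

lemma jensen_exp {ℓ p : ℝ} (hℓ : 0 < ℓ) {a : ℝ → ℝ} (ha : Continuous a) :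
    Real.exp (p * ∫ v in (0:ℝ)..ℓ, a v) ≤
      (1 / ℓ) * ∫ v in Set.Icc (0:ℝ) ℓ, Real.exp (ℓ * p * a v) := by
  rw [integral_Icc_eq_integral_Ioc, ← intervalIntegral.integral_of_le hℓ.le]
  set I := ∫ v in (0:ℝ)..ℓ, a v with hI
  have h1 : ∫ v in (0:ℝ)..ℓ, (Real.exp (p * I) * (1 - p * I) + Real.exp (p * I) * (ℓ * p) * a v) ≤
      ∫ v in (0:ℝ)..ℓ, Real.exp (ℓ * p * a v) := by
    apply intervalIntegral.integral_mono_on hℓ.le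
    · apply Continuous.intervalIntegrable; fun_prop
    · apply Continuous.intervalIntegrable; fun_prop
    · intro v _
      have h2 := Real.add_one_le_exp (ℓ * p * a v - p * I)
      have h3 : Real.exp (ℓ * p * a v) = Real.exp (p * I) * Real.exp (ℓ * p * a v - p * I) := by
        rw [← Real.exp_add]; congr 1; ring
      rw [h3]
      have := mul_le_mul_of_nonneg_left h2 (Real.exp_pos (p * I)).le
      linarith
  rw [intervalIntegral.integral_add (by simp) (by apply Continuous.intervalIntegrable; fun_prop),
    intervalIntegral.integral_const_mul (Real.exp (p * I) * (ℓ * p)), ← hI] at h1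
  simp only [intervalIntegral.integral_const, sub_zero, smul_eq_mul] at h1
  rw [one_div, ← div_eq_inv_mul, le_div_iff₀ hℓ]
  linarith

namespace FlowSetup
variable {n : ℕ} {ℓ K p : ℝ} {Ω : Set (EuclideanSpace ℝ (Fin n))}
  {b : ℝ → EuclideanSpace ℝ (Fin n) → EuclideanSpace ℝ (Fin n)}
  {D : ℝ → EuclideanSpace ℝ (Fin n) → (EuclideanSpace ℝ (Fin n) →L[ℝ] EuclideanSpace ℝ (Fin n))}
  {X : ℝ → ℝ → EuclideanSpace ℝ (Fin n) → EuclideanSpace ℝ (Fin n)}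

lemma intOn (h : FlowSetup ℓ K Ω b D X) {f : EuclideanSpace ℝ (Fin n) → ℝ} (hf : Continuous f) :
    IntegrableOn f Ω :=
  (hf.continuousOn.integrableOn_compact h.hΩb.isCompact_closure).mono_set subset_closure

lemma fin (h : FlowSetup ℓ K Ω b D X) : IsFiniteMeasure (volume.restrict Ω) :=
  ⟨by rw [Measure.restrict_apply_univ]; exact h.hΩb.measure_lt_top⟩

lemma intProd (h : FlowSetup ℓ K Ω b D X) (c : ℝ)
    {G : ℝ → EuclideanSpace ℝ (Fin n) → EuclideanSpace ℝ (Fin n)}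
    (hG : Continuous (fun q : ℝ × EuclideanSpace ℝ (Fin n) => G q.1 q.2)) :
    Integrable (fun q : ℝ × EuclideanSpace ℝ (Fin n) => Real.exp (c * ‖D q.1 (G q.1 q.2)‖))
      ((volume.restrict (Set.Icc 0 ℓ)).prod (volume.restrict Ω)) := by
  have := h.fin
  have hc : Continuous (fun q : ℝ × EuclideanSpace ℝ (Fin n) =>
      Real.exp (c * ‖D q.1 (G q.1 q.2)‖)) :=
    Real.continuous_exp.comp (continuous_const.mul
      (h.hD.comp (continuous_fst.prodMk hG)).norm)
  refine Integrable.of_bound hc.aestronglyMeasurable (Real.exp (|c| * K)) ?_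
  refine Filter.Eventually.of_forall fun q => ?_
  rw [Real.norm_eq_abs, abs_of_pos (Real.exp_pos _)]
  gcongr
  · exact le_abs_self c
  · exact h.hK _ _

lemma change_var (h : FlowSetup ℓ K Ω b D X) {s v : ℝ} (hs : s ∈ Set.Icc 0 ℓ)
    (hv : v ∈ Set.Icc 0 ℓ) (g : EuclideanSpace ℝ (Fin n) → ℝ) :
    ∫ x in Ω, g (X v s x) = ∫ y in Ω, |(h.J hv s y).det| * g y := by
  have h1 := integral_image_eq_integral_abs_det_fderiv_smul volume h.hΩo.measurableSet
    (f := X s v) (f' := h.J hv s) (fun x _ => (h.hasFDerivAt hv hs x).hasFDerivWithinAt)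
    (fun x _ y _ hxy => by
      rw [← h.X_inv hv hs x, ← h.X_inv hv hs y]
      exact congrArg _ hxy) (fun x => g (X v s x))
  rw [h.X_image hv hs] at h1
  simpa [h.X_inv hv hs] using h1

lemma young (h : FlowSetup ℓ K Ω b D X) (hn : 1 ≤ n) (hp : (n : ℝ) < p) {s v : ℝ}
    (hs : s ∈ Set.Icc 0 ℓ)
    (hv : v ∈ Set.Icc 0 ℓ) (y : EuclideanSpace ℝ (Fin n)) :
    |(h.J hv s y).det| * Real.exp (ℓ * p * ‖D v y‖) ≤
      (p - n) / p * Real.exp ((ℓ * p ^ 2 / (p - (n : ℝ))) * ‖D v y‖) +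
        n / p * ‖h.J hv s y‖ ^ p := by
  have hp0 : 0 < p := lt_of_le_of_lt (Nat.cast_nonneg n) hp
  have hpn : 0 < p - n := sub_pos.2 hp
  have := Real.geom_mean_le_arith_mean2_weighted (w₁ := (p - n) / p) (w₂ := n / p)
    (p₁ := Real.exp ((ℓ * p ^ 2 / (p - (n : ℝ))) * ‖D v y‖)) (p₂ := ‖h.J hv s y‖ ^ p)
    (by positivity) (by positivity) (by positivity) (by positivity) (by field_simp; ring)
  refine le_trans ?_ this
  rw [← Real.exp_mul, ← Real.rpow_mul (norm_nonneg _)]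
  have e1 : ℓ * p ^ 2 / (p - n) * ‖D v y‖ * ((p - n) / p) = ℓ * p * ‖D v y‖ := by
    field_simp
  have e2 : p * (n / p) = n := by field_simp
  rw [e1, e2, Real.rpow_natCast, mul_comm]
  gcongr
  exact abs_det_le_norm_pow _

lemma J_pow_cont (h : FlowSetup ℓ K Ω b D X) (hp : 0 ≤ p) {s t : ℝ} (hs : s ∈ Set.Icc 0 ℓ)
    (ht : t ∈ Set.Icc 0 ℓ) : Continuous (fun x => ‖h.J hs t x‖ ^ p) :=
  (h.J_cont hs ht).norm.rpow_const (fun _ => Or.inr hp)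

lemma step (h : FlowSetup ℓ K Ω b D X) (hn : 1 ≤ n) (hp : (n : ℝ) < p) {M : ℝ}
    (hM : ∀ s, ∀ hs : s ∈ Set.Icc 0 ℓ, ∀ t ∈ Set.Icc 0 ℓ, ∫ x in Ω, ‖h.J hs t x‖ ^ p ≤ M)
    {s t : ℝ} (hs : s ∈ Set.Icc 0 ℓ) (ht : t ∈ Set.Icc 0 ℓ) :
    ∫ x in Ω, ‖h.J hs t x‖ ^ p ≤ (p - n) / p * ((1 / ℓ) * ∫ v in Set.Icc (0:ℝ) ℓ,
          ∫ y in Ω, Real.exp ((ℓ * p ^ 2 / (p - (n : ℝ))) * ‖D v y‖)) + n / p * M := by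
  have hp0 : 0 < p := lt_of_le_of_lt (Nat.cast_nonneg n) hp
  have hpn : 0 < p - n := sub_pos.2 hp
  have hℓ := h.hℓ
  have := h.fin
  have hI1 := h.intProd (ℓ * p) (h.ext_cont hs)
  have hI2 := h.intProd (ℓ * p ^ 2 / (p - (n : ℝ))) (G := fun _ y => y) continuous_snd
  have hpt : ∀ x, ‖h.J hs t x‖ ^ p ≤
      (1 / ℓ) * ∫ v in Set.Icc (0:ℝ) ℓ, Real.exp (ℓ * p * ‖D v (h.ext s v x)‖) := by
    intro x
    refine le_trans ?_ (jensen_exp hℓ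
      (h.hD.comp (continuous_id.prodMk (h.ext_cont_time hs x))).norm)
    rw [mul_comm p, Real.exp_mul]
    exact Real.rpow_le_rpow (norm_nonneg _) (h.J_bound hs ht x) hp0.le
  have hslice : ∀ v ∈ Set.Icc (0:ℝ) ℓ, ∫ x in Ω, Real.exp (ℓ * p * ‖D v (h.ext s v x)‖) ≤
      (p - n) / p * (∫ y in Ω, Real.exp ((ℓ * p ^ 2 / (p - (n : ℝ))) * ‖D v y‖)) + n / p * M := by
    intro v hv
    have hDv : Continuous (D v) := h.hD.comp (continuous_const.prodMk continuous_id)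
    have hJc := h.J_cont hv hs
    have i1 : IntegrableOn (fun y => |(h.J hv s y).det| * Real.exp (ℓ * p * ‖D v y‖)) Ω := by
      apply h.intOn
      have : Continuous fun y => (h.J hv s y).det :=
        ContinuousLinearMap.continuous_det.comp hJc
      fun_prop
    have i2 : IntegrableOn (fun y => Real.exp ((ℓ * p ^ 2 / (p - (n : ℝ))) * ‖D v y‖)) Ω :=
      h.intOn (by fun_prop)
    have i3 : IntegrableOn (fun y => ‖h.J hv s y‖ ^ p) Ω :=
      h.intOn (h.J_pow_cont hp0.le hv hs)
    simp only [h.ext_eq hv]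
    rw [h.change_var hs hv (fun y => Real.exp (ℓ * p * ‖D v y‖))]
    refine (integral_mono i1 ((i2.const_mul _).add (i3.const_mul _))
      (fun y => h.young hn hp hs hv y)).trans ?_
    simp only [Pi.add_apply]
    rw [integral_add (i2.const_mul _) (i3.const_mul _), integral_const_mul, integral_const_mul]
    gcongr
    exact hM v hv s hs
  calc ∫ x in Ω, ‖h.J hs t x‖ ^ p
      ≤ ∫ x in Ω, (1 / ℓ) * ∫ v in Set.Icc (0:ℝ) ℓ, Real.exp (ℓ * p * ‖D v (h.ext s v x)‖) :=
        integral_mono (h.intOn (h.J_pow_cont hp0.le hs ht)) (hI1.integral_prod_right.const_mul _) hpt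
    _ = (1 / ℓ) * ∫ v in Set.Icc (0:ℝ) ℓ, ∫ x in Ω, Real.exp (ℓ * p * ‖D v (h.ext s v x)‖) := by
        rw [integral_const_mul, integral_integral_swap]
        exact hI1.swap
    _ ≤ (1 / ℓ) * ∫ v in Set.Icc (0:ℝ) ℓ, ((p - n) / p *
          (∫ y in Ω, Real.exp ((ℓ * p ^ 2 / (p - (n : ℝ))) * ‖D v y‖)) + n / p * M) := by
        refine mul_le_mul_of_nonneg_left ?_ (by positivity)
        exact setIntegral_mono_on hI1.integral_prod_left
          ((hI2.integral_prod_left.const_mul _).add (integrable_const _)) measurableSet_Icc hslice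
    _ = _ := by
        rw [integral_add (hI2.integral_prod_left.const_mul _) (integrable_const _),
          integral_const_mul, integral_const]
        simp only [MeasurableSet.univ, measureReal_restrict_apply, Set.univ_inter,
          Real.volume_real_Icc_of_le hℓ.le, sub_zero, smul_eq_mul]
        field_simp

lemma final (h : FlowSetup ℓ K Ω b D X) (hn : 1 ≤ n) (hp : (n : ℝ) < p)
    {s t : ℝ} (hs : s ∈ Set.Icc 0 ℓ) (ht : t ∈ Set.Icc 0 ℓ) :
    ∫ x in Ω, ‖h.J hs t x‖ ^ p ≤ (1 / ℓ) * ∫ v in Set.Icc (0:ℝ) ℓ,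
          ∫ y in Ω, Real.exp ((ℓ * p ^ 2 / (p - (n : ℝ))) * ‖D v y‖) := by
  have hp0 : 0 < p := lt_of_le_of_lt (Nat.cast_nonneg n) hp
  have hpn : 0 < p - n := sub_pos.2 hp
  have := h.fin
  set B := (1 / ℓ) * ∫ v in Set.Icc (0:ℝ) ℓ,
          ∫ y in Ω, Real.exp ((ℓ * p ^ 2 / (p - (n : ℝ))) * ‖D v y‖)
  let S : Set ℝ := {r | ∃ s, ∃ hs : s ∈ Set.Icc 0 ℓ, ∃ t ∈ Set.Icc 0 ℓ,
    r = ∫ x in Ω, ‖h.J hs t x‖ ^ p}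
  have hS : BddAbove S := by
    refine ⟨∫ x in Ω, Real.exp (K * ℓ) ^ p, ?_⟩
    rintro _ ⟨s, hs, t, ht, rfl⟩
    refine integral_mono (h.intOn (h.J_pow_cont hp0.le hs ht)) (integrable_const _) fun x => ?_
    exact Real.rpow_le_rpow (norm_nonneg _) (h.J_bound' hs ht x) hp0.le
  have hle : ∀ s, ∀ hs : s ∈ Set.Icc 0 ℓ, ∀ t ∈ Set.Icc 0 ℓ,
      ∫ x in Ω, ‖h.J hs t x‖ ^ p ≤ sSup S :=
    fun s hs t ht => le_csSup hS ⟨s, hs, t, ht, rfl⟩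
  have hsup : sSup S ≤ (p - n) / p * B + n / p * sSup S := by
    refine csSup_le ⟨_, s, hs, t, ht, rfl⟩ ?_
    rintro _ ⟨s, hs, t, ht, rfl⟩
    exact h.step hn hp hle hs ht
  refine (hle s hs t ht).trans ?_
  have e : (p - n) / p * B + n / p * sSup S - sSup S = (p - n) / p * (B - sSup S) := by
    field_simp; ring
  have h1 : 0 ≤ (p - n) / p * (B - sSup S) := by rw [← e]; linarith
  have h2 := nonneg_of_mul_nonneg_right h1 (by positivity)
  linarith

end FlowSetup

theorem stmt_16 (n : ℕ) (hn : 1 ≤ n) (ℓ p : ℝ) (hℓ : 0 < ℓ) (hp : (n : ℝ) < p)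
    (Ω : Set (EuclideanSpace ℝ (Fin n))) (hΩ_open : IsOpen Ω)
    (hΩ_bdd : Bornology.IsBounded Ω)
    (b : ℝ → EuclideanSpace ℝ (Fin n) → EuclideanSpace ℝ (Fin n))
    (hb_bdd : ∃ M : ℝ, ∀ t x, ‖b t x‖ ≤ M)
    (hb_cont : ContinuousOn (fun q : ℝ × EuclideanSpace ℝ (Fin n) => b q.1 q.2)
      (Set.Icc (0:ℝ) ℓ ×ˢ Set.univ))
    (Dxb : ℝ → EuclideanSpace ℝ (Fin n) →
      (EuclideanSpace ℝ (Fin n) →L[ℝ] EuclideanSpace ℝ (Fin n)))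
    (hDxb : ∀ t ∈ Set.Icc (0:ℝ) ℓ, ∀ x, HasFDerivAt (b t) (Dxb t x) x)
    (hDxb_cont : ContinuousOn (fun q : ℝ × EuclideanSpace ℝ (Fin n) => Dxb q.1 q.2)
      (Set.Icc (0:ℝ) ℓ ×ˢ Set.univ))
    (hsupp : ∀ t ∈ Set.Icc (0:ℝ) ℓ, ∀ x, x ∉ Ω → b t x = 0)
    (X : ℝ → ℝ → EuclideanSpace ℝ (Fin n) → EuclideanSpace ℝ (Fin n))
    (hX_init : ∀ s ∈ Set.Icc (0:ℝ) ℓ, ∀ x, X s s x = x)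
    (hX_ode : ∀ s ∈ Set.Icc (0:ℝ) ℓ, ∀ t ∈ Set.Icc (0:ℝ) ℓ, ∀ x,
      HasDerivWithinAt (fun τ => X τ s x) (b t (X t s x)) (Set.Icc (0:ℝ) ℓ) t) :
    ∀ s ∈ Set.Icc (0:ℝ) ℓ, ∀ t ∈ Set.Icc (0:ℝ) ℓ,
      ContDiff ℝ 1 (fun x => X t s x) ∧
      ∫ x in Ω, ‖fderiv ℝ (fun x => X t s x) x‖ ^ p ≤
        (1 / ℓ) * ∫ v in Set.Icc (0:ℝ) ℓ,
          ∫ y in Ω, Real.exp ((ℓ * p ^ 2 / (p - (n : ℝ))) * ‖Dxb v y‖) := by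
  let π : ℝ → ℝ := fun t => max 0 (min ℓ t)
  have hπc : Continuous π := by fun_prop
  have hπ : ∀ t, π t ∈ Set.Icc 0 ℓ := fun t =>
    ⟨le_max_left _ _, max_le hℓ.le (min_le_left _ _)⟩
  have hπe : ∀ t ∈ Set.Icc 0 ℓ, π t = t := fun t ht => by
    simp only [π]; rw [min_eq_right ht.2, max_eq_right ht.1]
  obtain ⟨K, hK⟩ := ((isCompact_Icc (a := (0:ℝ)) (b := ℓ)).prod
    hΩ_bdd.isCompact_closure).exists_bound_of_continuousOn
    (hDxb_cont.mono (Set.prod_mono_right (Set.subset_univ _)))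
  have hKall : ∀ t ∈ Set.Icc 0 ℓ, ∀ x, ‖Dxb t x‖ ≤ max K 0 := by
    intro t ht x
    by_cases hx : x ∈ closure Ω
    · exact (hK (t, x) ⟨ht, hx⟩).trans (le_max_left _ _)
    · have h0 : b t =ᶠ[nhds x] fun _ => 0 := by
        filter_upwards [isClosed_closure.isOpen_compl.mem_nhds hx] with y hy
        exact hsupp t ht y (fun hyΩ => hy (subset_closure hyΩ))
      have h1 : HasFDerivAt (𝕜 := ℝ) (b t) 0 x := (hasFDerivAt_const 0 x).congr_of_eventuallyEq h0
      rw [(hDxb t ht x).unique h1]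
      simp
  have h : FlowSetup ℓ (max K 0) Ω (fun t => b (π t)) (fun t => Dxb (π t)) X :=
    { hℓ := hℓ
      hΩo := hΩ_open
      hΩb := hΩ_bdd
      hD := hDxb_cont.comp_continuous (f := fun q : ℝ × EuclideanSpace ℝ (Fin n) => (π q.1, q.2))
        (by fun_prop) (fun q => ⟨hπ _, trivial⟩)
      hd := fun t x => hDxb _ (hπ t) x
      hK := fun t x => hKall _ (hπ t) x
      hs := fun t x hx => hsupp _ (hπ t) x hx
      start := hX_init
      ode := fun s hs t ht x => by
        simp only [hπe t ht]
        exact hX_ode s hs t ht x }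
  intro s hs t ht
  refine ⟨h.contDiff hs ht, ?_⟩
  have hJ : ∀ x, fderiv ℝ (fun x => X t s x) x = h.J hs t x := fun x =>
    (h.hasFDerivAt hs ht x).fderiv
  simp only [hJ]
  refine (h.final hn hp hs ht).trans (le_of_eq ?_)
  congr 1
  refine setIntegral_congr_fun measurableSet_Icc fun v hv => ?_
  simp only [hπe v hv]
end
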